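/- arXiv:2212.00315 — 2 statements merged into one kernel-verified Lean document; each statement's English description precedes it below -/
import Mathlib

section
/- Let (T(t))_{t≥0} be a bounded C₀-semigroup on a complex Hilbert space X with generator A, and let C be a bounded linear operator on X commuting with T(t) for every t ≥ 0 (C T(t) = T(t) C). Fix 0 ≤ β < 1 and γ ≥ 0. Then the following are equivalent: (i) there exist M, t₁ > 0 such that ‖C T(t)‖ ≤ M / (t^β (log t)^γ) for all t ≥ t₁; (ii) there exists K > 0 such that ‖C R(λ,A)‖ ≤ K / ((Re λ)^{1−β} |log Re λ|^γ) for all λ with 0 < Re λ < 1. (This is the content of the paper's characterization of non-polynomial decay ‖T(t)(−A)^{-α}‖ = O(t^{-β}(log t)^{-γ}), stated for a general bounded operator C commuting with the semigroup, as in its proof.) -/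
open MeasureTheory Set Filter Topology FourierTransform
open scoped ContDiff

/-- The Fourier integral of an `L¹ ∩ L²` function represents its `L²` Fourier transform. -/
theorem Lp_fourier_toLp_ae_eq {X : Type*} [NormedAddCommGroup X] [InnerProductSpace ℂ X]
    [CompleteSpace X] {f : ℝ → X} (hf : Integrable f) (hf2 : MemLp f 2) :
    (𝓕 (hf2.toLp f) : Lp (α := ℝ) X 2) =ᵐ[volume] 𝓕 f := by
  have hc : Continuous (𝓕 f) := VectorFourier.fourierIntegral_continuous (L := innerₗ ℝ)
    Real.continuous_fourierChar continuous_inner hf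
  refine ae_eq_of_integral_contDiff_smul_eq
    ((Lp.memLp (𝓕 (hf2.toLp f) : Lp (α := ℝ) X 2 volume)).locallyIntegrable (by norm_num))
    hc.locallyIntegrable ?_
  intro g hg hgs
  have hgs' : HasCompactSupport (fun x => (g x : ℂ)) := hgs.comp_left (g := Complex.ofReal) rfl
  have hg' : ContDiff ℝ ∞ (fun x => (g x : ℂ)) := Complex.ofRealCLM.contDiff.comp hg
  let G : SchwartzMap ℝ ℂ := hgs'.toSchwartzMap hg'
  have h1 := congrArg (fun D => D G) (Lp.fourier_toTemperedDistribution_eq (hf2.toLp f))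
  simp only [TemperedDistribution.fourier_apply, Lp.toTemperedDistribution_apply] at h1
  have h2 : ∀ (h : ℝ → X), ∫ x, g x • h x = ∫ x, G x • h x := fun h => by
    congr 1
  rw [h2, h2, ← h1]
  have h3 : ∫ x, (𝓕 G) x • (hf2.toLp f) x = ∫ x, (𝓕 (G : ℝ → ℂ)) x • f x := by
    refine integral_congr_ae ?_
    filter_upwards [hf2.coeFn_toLp] with x hx
    rw [hx, SchwartzMap.fourier_coe]
  rw [h3]
  exact (VectorFourier.integral_fourierIntegral_smul_eq_flip (L := innerₗ ℝ)
    Real.continuous_fourierChar continuous_inner G.integrable hf).trans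
      (by simp [Real.fourier_eq, VectorFourier.fourierIntegral, flip_innerₗ])

/-- Plancherel's theorem for Hilbert space valued `L¹ ∩ L²` functions. -/
theorem eLpNorm_fourier_eq {X : Type*} [NormedAddCommGroup X] [InnerProductSpace ℂ X]
    [CompleteSpace X] {f : ℝ → X} (hf : Integrable f) (hf2 : MemLp f 2) :
    eLpNorm (𝓕 f) 2 volume = eLpNorm f 2 volume := by
  rw [← eLpNorm_congr_ae (Lp_fourier_toLp_ae_eq hf hf2), ← eLpNorm_congr_ae hf2.coeFn_toLp,
    ← Lp.enorm_def, ← Lp.enorm_def, ← ofReal_norm, ← ofReal_norm, Lp.norm_fourier_eq]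

/-- A pointwise bound between the Fourier transforms of two `L¹ ∩ L²` functions gives the same
bound between their `L²` norms. -/
theorem integral_norm_sq_le_of_norm_fourier_le {X : Type*} [NormedAddCommGroup X]
    [InnerProductSpace ℂ X] [CompleteSpace X] {f F : ℝ → X} (hf : Integrable f)
    (hf2 : MemLp f 2) (hF : Integrable F) (hF2 : MemLp F 2) {G : ℝ} (hG : 0 ≤ G)
    (h : ∀ η, ‖𝓕 F η‖ ≤ G * ‖𝓕 f η‖) :
    ∫ s, ‖F s‖ ^ 2 ≤ G ^ 2 * ∫ s, ‖f s‖ ^ 2 := by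
  have h1 : eLpNorm F 2 volume ≤ ENNReal.ofReal G * eLpNorm f 2 volume := by
    rw [← eLpNorm_fourier_eq hF hF2, ← eLpNorm_fourier_eq hf hf2]
    exact eLpNorm_le_mul_eLpNorm_of_ae_le_mul (Eventually.of_forall h) 2
  have key : ∀ {g : ℝ → X}, MemLp g 2 → (eLpNorm g 2 volume).toReal ^ 2 = ∫ s, ‖g s‖ ^ 2 := by
    intro g hg
    rw [hg.eLpNorm_eq_integral_rpow_norm (by norm_num) (by norm_num), ENNReal.toReal_ofReal
      (by positivity), ← Real.rpow_natCast, ← Real.rpow_mul (by positivity)]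
    simp
  rw [← key hF2, ← key hf2, ← mul_pow]
  refine pow_le_pow_left₀ ENNReal.toReal_nonneg ?_ 2
  have := ENNReal.toReal_mono (ENNReal.mul_ne_top ENNReal.ofReal_ne_top hf2.eLpNorm_ne_top) h1
  rwa [ENNReal.toReal_mul, ENNReal.toReal_ofReal hG] at this

/-- Fundamental theorem of calculus on `(a, ∞)` for right derivatives. -/
theorem integral_Ioi_of_hasDerivWithinAt_Ioi_of_tendsto {E : Type*} [NormedAddCommGroup E]
    [NormedSpace ℝ E] [CompleteSpace E] {f f' : ℝ → E} {a : ℝ} {m : E}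
    (hcont : ContinuousOn f (Ici a))
    (hderiv : ∀ x ∈ Ioi a, HasDerivWithinAt f (f' x) (Ioi x) x)
    (h_int : IntegrableOn f' (Ioi a)) (hlim : Tendsto f atTop (𝓝 m)) :
    ∫ x in Ioi a, f' x = m - f a := by
  refine tendsto_nhds_unique (intervalIntegral_tendsto_integral_Ioi a h_int tendsto_id) ?_
  refine (hlim.sub_const (f a)).congr' ?_
  filter_upwards [eventually_ge_atTop a] with b hb
  refine (intervalIntegral.integral_eq_sub_of_hasDeriv_right_of_le hb
    (hcont.mono Icc_subset_Ici_self) (fun x hx => hderiv x hx.1) ?_).symm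
  rw [intervalIntegrable_iff_integrableOn_Ioc_of_le hb]
  exact h_int.mono_set Ioc_subset_Ioi_self

theorem integrableOn_pow_mul_exp_neg {a : ℝ} (ha : 0 < a) (n : ℕ) :
    IntegrableOn (fun s : ℝ => s ^ n * Real.exp (-(a * s))) (Ioi 0) := by
  have := integrableOn_rpow_mul_exp_neg_mul_rpow (p := 1) (s := n) (b := a)
    (by have : (0 : ℝ) ≤ n := n.cast_nonneg
        linarith) one_pos ha
  simpa [neg_mul] using this

section Semigroup

variable {X : Type*} [NormedAddCommGroup X] [NormedSpace ℂ X] {T : ℝ → X →L[ℂ] X}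

theorem hasDerivWithinAt_semigroup
    (hTsemi : ∀ s t : ℝ, 0 ≤ s → 0 ≤ t → T (s + t) = T s ∘L T t) {x y : X}
    (hxy : Tendsto (fun t : ℝ => (t : ℂ)⁻¹ • (T t x - x)) (𝓝[>] 0) (𝓝 y))
    {s : ℝ} (hs : 0 ≤ s) :
    HasDerivWithinAt (fun r : ℝ => T r x) (T s y) (Ioi s) s := by
  rw [hasDerivWithinAt_iff_tendsto_slope' self_notMem_Ioi]
  have h1 : Tendsto (fun r : ℝ => r - s) (𝓝[>] s) (𝓝[>] 0) := by
    refine tendsto_nhdsWithin_iff.2 ⟨?_, ?_⟩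
    · exact (tendsto_nhdsWithin_of_tendsto_nhds
        ((continuous_sub_right s).tendsto' s 0 (sub_self s)))
    · filter_upwards [self_mem_nhdsWithin] with r hr using sub_pos.2 (mem_Ioi.1 hr)
  refine (((T s).continuous.tendsto y).comp (hxy.comp h1)).congr' ?_
  filter_upwards [self_mem_nhdsWithin] with r hr
  have hr' : s ≤ r := le_of_lt hr
  have : T r x = T s (T (r - s) x) := by
    rw [← ContinuousLinearMap.comp_apply, ← hTsemi s (r - s) hs (sub_nonneg.2 hr')]
    simp
  simp only [Function.comp, slope_def_module, this, map_smul, map_sub]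
  rw [← Complex.ofReal_inv, Complex.coe_smul]

theorem hasDerivWithinAt_exp_smul_semigroup
    (hTsemi : ∀ s t : ℝ, 0 ≤ s → 0 ≤ t → T (s + t) = T s ∘L T t) {x y : X}
    (hxy : Tendsto (fun t : ℝ => (t : ℂ)⁻¹ • (T t x - x)) (𝓝[>] 0) (𝓝 y))
    (lam : ℂ) {s : ℝ} (hs : 0 ≤ s) :
    HasDerivWithinAt (fun r : ℝ => Complex.exp (-(lam * r)) • T r x)
      (-(Complex.exp (-(lam * s)) • T s (lam • x - y))) (Ioi s) s := by
  have h0 : HasDerivAt (fun r : ℝ => Complex.exp (-(lam * r)))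
      (Complex.exp (-(lam * s)) * (-(lam * 1))) s :=
    ((Complex.ofRealCLM.hasDerivAt (x := s)).const_mul lam).neg.cexp
  have h1 := h0.hasDerivWithinAt.smul (hasDerivWithinAt_semigroup hTsemi hxy hs)
  refine h1.congr_deriv ?_
  simp only [map_sub, map_smul]
  module

theorem norm_exp_neg_smul_semigroup_le {c : ℝ} (hc : ∀ t : ℝ, 0 ≤ t → ‖T t‖ ≤ c) (lam : ℂ) (x : X)
    {s : ℝ} (hs : 0 ≤ s) :
    ‖Complex.exp (-(lam * s)) • T s x‖ ≤ c * ‖x‖ * Real.exp (-(lam.re * s)) := by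
  rw [norm_smul, Complex.norm_exp, mul_comm]
  have : (-(lam * s)).re = -(lam.re * s) := by simp
  rw [this]
  gcongr
  exact (T s).le_of_opNorm_le (hc s hs) x

theorem continuousOn_exp_neg_smul_semigroup
    (hTcont : ∀ x : X, ContinuousOn (fun t : ℝ => T t x) (Ici 0)) (lam : ℂ) (x : X) :
    ContinuousOn (fun s : ℝ => Complex.exp (-(lam * s)) • T s x) (Ici 0) := by
  have : Continuous (fun s : ℝ => Complex.exp (-(lam * s))) := by fun_prop
  exact this.continuousOn.smul (hTcont x)

theorem integrableOn_pow_smul_semigroup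
    (hTcont : ∀ x : X, ContinuousOn (fun t : ℝ => T t x) (Ici 0))
    {c : ℝ} (hc : ∀ t : ℝ, 0 ≤ t → ‖T t‖ ≤ c) {lam : ℂ} (hlam : 0 < lam.re) (x : X) (n : ℕ) :
    IntegrableOn (fun s : ℝ => (s : ℂ) ^ n • Complex.exp (-(lam * s)) • T s x) (Ioi 0) := by
  have hcn : Continuous (fun s : ℝ => (s : ℂ) ^ n) := by fun_prop
  refine ((integrableOn_pow_mul_exp_neg hlam n).const_mul (c * ‖x‖)).mono'
    (((hcn.continuousOn.smul (continuousOn_exp_neg_smul_semigroup hTcont lam x)).mono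
      Ioi_subset_Ici_self).aestronglyMeasurable measurableSet_Ioi) ?_
  filter_upwards [ae_restrict_mem measurableSet_Ioi] with s hs
  have hs' : 0 < s := hs
  rw [norm_smul, norm_pow, Complex.norm_real, Real.norm_of_nonneg hs'.le]
  have := mul_le_mul_of_nonneg_left (norm_exp_neg_smul_semigroup_le hc lam x hs'.le)
    (pow_nonneg hs'.le n)
  linarith

theorem tendsto_pow_smul_semigroup
    {c : ℝ} (hc : ∀ t : ℝ, 0 ≤ t → ‖T t‖ ≤ c) {lam : ℂ} (hlam : 0 < lam.re) (x : X) (n : ℕ) :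
    Tendsto (fun s : ℝ => (s : ℂ) ^ n • Complex.exp (-(lam * s)) • T s x) atTop (𝓝 0) := by
  have h0 := (tendsto_rpow_mul_exp_neg_mul_atTop_nhds_zero n lam.re hlam).const_mul (c * ‖x‖)
  rw [mul_zero] at h0
  refine squeeze_zero_norm' ?_ h0
  filter_upwards [eventually_ge_atTop 0] with s hs
  rw [norm_smul, norm_pow, Complex.norm_real, Real.norm_of_nonneg hs, Real.rpow_natCast]
  have := mul_le_mul_of_nonneg_left (norm_exp_neg_smul_semigroup_le hc lam x hs)
    (pow_nonneg hs n)
  rw [neg_mul]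
  linarith

theorem memLp_two_pow_smul_semigroup
    (hTcont : ∀ x : X, ContinuousOn (fun t : ℝ => T t x) (Ici 0))
    {c : ℝ} (hc : ∀ t : ℝ, 0 ≤ t → ‖T t‖ ≤ c) {lam : ℂ} (hlam : 0 < lam.re) (x : X) (n : ℕ) :
    MemLp (fun s : ℝ => (s : ℂ) ^ n • Complex.exp (-(lam * s)) • T s x) 2
      (volume.restrict (Ioi 0)) := by
  rw [memLp_two_iff_integrable_sq_norm
    (integrableOn_pow_smul_semigroup hTcont hc hlam x n).aestronglyMeasurable]
  refine ((integrableOn_pow_mul_exp_neg (mul_pos two_pos hlam) (2 * n)).const_mul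
    ((c * ‖x‖) ^ 2)).mono'
    ((integrableOn_pow_smul_semigroup hTcont hc hlam x n).aestronglyMeasurable.norm.pow 2) ?_
  filter_upwards [ae_restrict_mem measurableSet_Ioi] with s hs
  have hs' : 0 < s := hs
  rw [Real.norm_of_nonneg (by positivity), norm_smul, norm_pow, Complex.norm_real,
    Real.norm_of_nonneg hs'.le, mul_pow, ← pow_mul, mul_comm n 2]
  have h1 := pow_le_pow_left₀ (norm_nonneg _)
    (norm_exp_neg_smul_semigroup_le hc lam x hs'.le) 2
  have h2 : Real.exp (-(2 * lam.re * s)) = Real.exp (-(lam.re * s)) ^ 2 := by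
    rw [← Real.exp_nat_mul]; congr 1; push_cast; ring
  rw [h2]
  have := mul_le_mul_of_nonneg_left h1 (pow_nonneg hs'.le (2 * n))
  linarith

variable [CompleteSpace X]

/-- The Laplace transform of the semigroup inverts `lam - A`: it maps `lam • y - A y` to `y`. -/
theorem integral_exp_smul_semigroup (hT0 : T 0 = 1)
    (hTsemi : ∀ s t : ℝ, 0 ≤ s → 0 ≤ t → T (s + t) = T s ∘L T t)
    (hTcont : ∀ x : X, ContinuousOn (fun t : ℝ => T t x) (Ici 0))
    {c : ℝ} (hc : ∀ t : ℝ, 0 ≤ t → ‖T t‖ ≤ c) {lam : ℂ} (hlam : 0 < lam.re) {y z : X}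
    (hyz : Tendsto (fun t : ℝ => (t : ℂ)⁻¹ • (T t y - y)) (𝓝[>] 0) (𝓝 z)) :
    ∫ s in Ioi (0 : ℝ), Complex.exp (-(lam * s)) • T s (lam • y - z) = y := by
  have h := integral_Ioi_of_hasDerivWithinAt_Ioi_of_tendsto
    (continuousOn_exp_neg_smul_semigroup hTcont lam y)
    (fun s hs => hasDerivWithinAt_exp_smul_semigroup hTsemi hyz lam (le_of_lt hs))
    (by simpa using (integrableOn_pow_smul_semigroup hTcont hc hlam (lam • y - z) 0).neg)
    (by simpa using tendsto_pow_smul_semigroup hc hlam y 0)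
  rw [integral_neg] at h
  simpa [hT0] using h

/-- The square of the resolvent as a Laplace transform. -/
theorem integral_id_smul_exp_smul_semigroup
    (hTsemi : ∀ s t : ℝ, 0 ≤ s → 0 ≤ t → T (s + t) = T s ∘L T t)
    (hTcont : ∀ x : X, ContinuousOn (fun t : ℝ => T t x) (Ici 0))
    {c : ℝ} (hc : ∀ t : ℝ, 0 ≤ t → ‖T t‖ ≤ c) {lam : ℂ} (hlam : 0 < lam.re) {y z : X}
    (hyz : Tendsto (fun t : ℝ => (t : ℂ)⁻¹ • (T t y - y)) (𝓝[>] 0) (𝓝 z)) :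
    ∫ s in Ioi (0 : ℝ), (s : ℂ) • Complex.exp (-(lam * s)) • T s (lam • y - z) =
      ∫ s in Ioi (0 : ℝ), Complex.exp (-(lam * s)) • T s y := by
  have hint0 : IntegrableOn (fun s : ℝ => Complex.exp (-(lam * s)) • T s y) (Ioi 0) := by
    simpa using integrableOn_pow_smul_semigroup hTcont hc hlam y 0
  have hint1 : IntegrableOn (fun s : ℝ => (s : ℂ) • Complex.exp (-(lam * s)) •
      T s (lam • y - z)) (Ioi 0) := by
    simpa using integrableOn_pow_smul_semigroup hTcont hc hlam (lam • y - z) 1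
  have hcn : Continuous (fun s : ℝ => (s : ℂ)) := by fun_prop
  have h := integral_Ioi_of_hasDerivWithinAt_Ioi_of_tendsto
    (f := fun s : ℝ => (s : ℂ) • Complex.exp (-(lam * s)) • T s y)
    (f' := fun s : ℝ => Complex.exp (-(lam * s)) • T s y -
      (s : ℂ) • Complex.exp (-(lam * s)) • T s (lam • y - z)) (a := 0) (m := 0)
    (hcn.continuousOn.smul (continuousOn_exp_neg_smul_semigroup hTcont lam y))
    (fun s hs => by
      have h1 := (Complex.ofRealCLM.hasDerivAt (x := s)).hasDerivWithinAt.smul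
        (hasDerivWithinAt_exp_smul_semigroup hTsemi hyz lam (le_of_lt hs))
      refine h1.congr_deriv ?_
      simp only [Complex.ofRealCLM_apply, Complex.ofReal_one]
      module)
    (hint0.sub hint1)
    (by simpa using tendsto_pow_smul_semigroup hc hlam y 1)
  rw [integral_sub hint0 hint1] at h
  have h' := sub_eq_zero.1 (h.trans (by simp))
  exact h'.symm

end Semigroup

section Hilbert

variable {X : Type*} [NormedAddCommGroup X] [InnerProductSpace ℂ X] [CompleteSpace X]
  {T : ℝ → X →L[ℂ] X} {R : ℂ → X →L[ℂ] X}

/-- A bound for `C R` on the line `Re lam = ξ` bounds the weighted `L²` norm of `s ↦ s C T(s) x`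
by that of the orbit `s ↦ T(s) x`. -/
theorem integral_norm_sq_semigroup_le_of_resolvent_le (hT0 : T 0 = 1)
    (hTsemi : ∀ s t : ℝ, 0 ≤ s → 0 ≤ t → T (s + t) = T s ∘L T t)
    (hTcont : ∀ x : X, ContinuousOn (fun t : ℝ => T t x) (Ici 0))
    {c : ℝ} (hc : ∀ t : ℝ, 0 ≤ t → ‖T t‖ ≤ c)
    (hR : ∀ lam : ℂ, 0 < lam.re → ∀ x, ∃ z, lam • R lam x - z = x ∧
      Tendsto (fun t : ℝ => (t : ℂ)⁻¹ • (T t (R lam x) - R lam x)) (𝓝[>] 0) (𝓝 z))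
    (C : X →L[ℂ] X) {ξ G : ℝ} (hξ : 0 < ξ)
    (hG : ∀ lam : ℂ, lam.re = ξ → ‖C ∘L R lam‖ ≤ G) (x : X) :
    IntegrableOn (fun s : ℝ => ‖C ((s : ℂ) • Complex.exp (-(ξ * s)) • T s x)‖ ^ 2) (Ioi 0) ∧
    ∫ s in Ioi (0 : ℝ), ‖C ((s : ℂ) • Complex.exp (-(ξ * s)) • T s x)‖ ^ 2 ≤
      G ^ 2 * ∫ s in Ioi (0 : ℝ), ‖Complex.exp (-(ξ * s)) • T s x‖ ^ 2 := by
  have hξ' : 0 < (ξ : ℂ).re := hξ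
  have hG0 : 0 ≤ G := (norm_nonneg _).trans (hG ξ rfl)
  have hf := integrableOn_pow_smul_semigroup hTcont hc hξ' x 0
  have hF := integrableOn_pow_smul_semigroup hTcont hc hξ' x 1
  have hf2 := memLp_two_pow_smul_semigroup hTcont hc hξ' x 0
  have hF2 := memLp_two_pow_smul_semigroup hTcont hc hξ' x 1
  simp only [pow_zero, one_smul, pow_one] at hf hF hf2 hF2
  have hCF := C.integrable_comp hF
  have hCF2 := C.comp_memLp' hF2
  refine ⟨(memLp_two_iff_integrable_sq_norm hCF.aestronglyMeasurable).1 hCF2, ?_⟩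
  have hind : ∀ g : ℝ → X, ∫ s in Ioi (0 : ℝ), ‖g s‖ ^ 2 =
      ∫ s, ‖(Ioi (0 : ℝ)).indicator g s‖ ^ 2 := fun g => by
    rw [← integral_indicator measurableSet_Ioi]
    congr 1 with s
    by_cases hs : s ∈ Ioi (0 : ℝ) <;> simp [hs]
  have hfour : ∀ (g : ℝ → X) (η : ℝ), 𝓕 ((Ioi (0 : ℝ)).indicator g) η =
      ∫ s in Ioi (0 : ℝ), Complex.exp (-(2 * Real.pi * η * Complex.I * s)) • g s :=
      fun g η => by
    rw [Real.fourier_real_eq_integral_exp_smul, ← integral_indicator measurableSet_Ioi]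
    congr 1 with s
    by_cases hs : s ∈ Ioi (0 : ℝ)
    · simp only [hs, indicator_of_mem]
      congr 2
      push_cast
      ring
    · simp [hs]
  rw [hind, hind]
  refine integral_norm_sq_le_of_norm_fourier_le
    ((integrable_indicator_iff measurableSet_Ioi).2 hf)
    ((memLp_indicator_iff_restrict measurableSet_Ioi).2 hf2)
    ((integrable_indicator_iff measurableSet_Ioi).2 hCF)
    ((memLp_indicator_iff_restrict measurableSet_Ioi).2 hCF2) hG0 fun η => ?_
  set lam : ℂ := ξ + 2 * Real.pi * η * Complex.I with hlamdef
  have hre : lam.re = ξ := by simp [hlamdef]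
  have hlam : 0 < lam.re := hre ▸ hξ
  have hexp : ∀ (s : ℝ) (v : X), Complex.exp (-(2 * Real.pi * η * Complex.I * s)) •
      Complex.exp (-(ξ * s)) • v = Complex.exp (-(lam * s)) • v := fun s v => by
    rw [smul_smul, ← Complex.exp_add]
    congr 2
    rw [hlamdef]
    ring
  obtain ⟨z, hz, hz'⟩ := hR lam hlam x
  obtain ⟨w, hw, hw'⟩ := hR lam hlam (R lam x)
  have hlap := integral_exp_smul_semigroup hT0 hTsemi hTcont hc hlam hz'
  have hlap' := integral_exp_smul_semigroup hT0 hTsemi hTcont hc hlam hw'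
  have hlap2 := integral_id_smul_exp_smul_semigroup hTsemi hTcont hc hlam hz'
  rw [hz] at hlap hlap2
  rw [hw] at hlap'
  rw [hlap'] at hlap2
  have e1 : 𝓕 ((Ioi (0 : ℝ)).indicator fun s : ℝ => Complex.exp (-(ξ * s)) • T s x) η =
      R lam x := by
    simp only [hfour, hexp]
    exact hlap
  have e2 : 𝓕 ((Ioi (0 : ℝ)).indicator fun s : ℝ =>
      C ((s : ℂ) • Complex.exp (-(ξ * s)) • T s x)) η = C (R lam (R lam x)) := by
    have h_int := integrableOn_pow_smul_semigroup hTcont hc hlam x 1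
    simp only [pow_one] at h_int
    rw [hfour, ← hlap2, ← C.integral_comp_comm h_int]
    refine integral_congr_ae (Eventually.of_forall fun s => ?_)
    simp only [← map_smul, smul_comm _ (s : ℂ), hexp]
  rw [e1, e2]
  exact (C ∘L R lam).le_of_opNorm_le (hG lam hre) _

/-- Decay of `C T(t)` from a bound for `C R` on the line `Re lam = 1 / t`. -/
theorem norm_comp_semigroup_le_of_resolvent_le (hT0 : T 0 = 1)
    (hTsemi : ∀ s t : ℝ, 0 ≤ s → 0 ≤ t → T (s + t) = T s ∘L T t)
    (hTcont : ∀ x : X, ContinuousOn (fun t : ℝ => T t x) (Ici 0))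
    {c : ℝ} (hc0 : 0 < c) (hc : ∀ t : ℝ, 0 ≤ t → ‖T t‖ ≤ c)
    (hR : ∀ lam : ℂ, 0 < lam.re → ∀ x, ∃ z, lam • R lam x - z = x ∧
      Tendsto (fun t : ℝ => (t : ℂ)⁻¹ • (T t (R lam x) - R lam x)) (𝓝[>] 0) (𝓝 z))
    (C : X →L[ℂ] X) (hcomm : ∀ t : ℝ, 0 ≤ t → C ∘L (T t) = (T t) ∘L C)
    {t G : ℝ} (ht : 0 < t) (hG : ∀ lam : ℂ, lam.re = t⁻¹ → ‖C ∘L R lam‖ ≤ G) :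
    ‖C ∘L T t‖ ≤ 4 * c ^ 2 * G / t := by
  have hG0 : 0 ≤ G := (norm_nonneg _).trans (hG (t⁻¹ : ℝ) rfl)
  have hti : 0 < t⁻¹ := inv_pos.2 ht
  refine ContinuousLinearMap.opNorm_le_bound _ (by positivity) fun x => ?_
  obtain ⟨h_int, hle⟩ := integral_norm_sq_semigroup_le_of_resolvent_le hT0 hTsemi hTcont hc hR C
    hti hG x
  have hexp2 : ∀ s : ℝ, Real.exp (-(2 * t⁻¹ * s)) = Real.exp (-(t⁻¹ * s)) ^ 2 := fun s => by
    rw [← Real.exp_nat_mul]; congr 1; push_cast; ring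
  have hup : ∫ s in Ioi (0 : ℝ), ‖Complex.exp (-((t⁻¹ : ℝ) * s)) • T s x‖ ^ 2 ≤
      (c * ‖x‖) ^ 2 * (t / 2) := by
    have hi := integrableOn_pow_mul_exp_neg (mul_pos two_pos hti) 0
    simp only [pow_zero, one_mul] at hi
    have hval : ∫ s in Ioi (0 : ℝ), Real.exp (-(2 * t⁻¹ * s)) = t / 2 := by
      have := integral_exp_mul_Ioi (a := -(2 * t⁻¹)) (by linarith) 0
      simp only [neg_mul] at this
      rw [this]
      field_simp
      simp
    rw [← hval, ← integral_const_mul]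
    refine integral_mono_of_nonneg (Eventually.of_forall fun s => by positivity)
      (hi.const_mul _) ?_
    filter_upwards [ae_restrict_mem measurableSet_Ioi] with s hs
    have := pow_le_pow_left₀ (norm_nonneg _)
      (norm_exp_neg_smul_semigroup_le hc ((t⁻¹ : ℝ) : ℂ) x (le_of_lt hs)) 2
    rwa [mul_pow, Complex.ofReal_re, ← hexp2] at this
  have hlow : (Real.exp (-1) * ‖C (T t x)‖ / c) ^ 2 * (t ^ 3 / 3) ≤
      ∫ s in Ioi (0 : ℝ), ‖C ((s : ℂ) • Complex.exp (-((t⁻¹ : ℝ) * s)) • T s x)‖ ^ 2 := by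
    have hval : ∫ s in Ioc (0 : ℝ) t, s ^ 2 = t ^ 3 / 3 := by
      rw [← intervalIntegral.integral_of_le ht.le, integral_pow]
      norm_num
    rw [← hval, ← integral_const_mul]
    have hsub : Ioc 0 t ⊆ Ioi (0 : ℝ) := Ioc_subset_Ioi_self
    refine le_trans ?_ (setIntegral_mono_set h_int
      (Eventually.of_forall fun s => by positivity) hsub.eventuallyLE)
    refine setIntegral_mono_on ?_ (h_int.mono_set Ioc_subset_Ioi_self) measurableSet_Ioc
      fun s hs => ?_
    · exact (by fun_prop : Continuous fun s : ℝ =>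
        (Real.exp (-1) * ‖C (T t x)‖ / c) ^ 2 * s ^ 2).integrableOn_Ioc
    · have hs0 : 0 < s := hs.1
      rw [← mul_pow]
      refine pow_le_pow_left₀ (by positivity) ?_ 2
      have h1 : ‖C (T t x)‖ ≤ c * ‖C (T s x)‖ := by
        have hts : 0 ≤ t - s := sub_nonneg.2 hs.2
        have : C (T t x) = T (t - s) (C (T s x)) := by
          rw [← ContinuousLinearMap.comp_apply (T (t - s)) C, ← hcomm _ hts,
            ContinuousLinearMap.comp_apply, ← ContinuousLinearMap.comp_apply (T (t - s)),
            ← hTsemi _ _ hts hs0.le, sub_add_cancel]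
        rw [this]
        exact (T (t - s)).le_of_opNorm_le (hc _ hts) _
      have h2 : Real.exp (-1) ≤ Real.exp (-(t⁻¹ * s)) := by
        refine Real.exp_le_exp.2 (neg_le_neg ?_)
        rw [inv_mul_le_iff₀ ht, mul_one]
        exact hs.2
      have h3 : ‖C ((s : ℂ) • Complex.exp (-((t⁻¹ : ℝ) * s)) • T s x)‖ =
          s * (Real.exp (-(t⁻¹ * s)) * ‖C (T s x)‖) := by
        rw [map_smul, map_smul, norm_smul, norm_smul, Complex.norm_real,
          Real.norm_of_nonneg hs0.le, Complex.norm_exp]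
        simp
      rw [h3, mul_comm]
      refine mul_le_mul_of_nonneg_left ?_ hs0.le
      rw [mul_div_assoc]
      exact mul_le_mul h2 ((div_le_iff₀' hc0).2 h1) (by positivity) (by positivity)
  have hmain := hlow.trans (hle.trans (mul_le_mul_of_nonneg_left hup (by positivity)))
  have hfin : (‖C (T t x)‖ * t) ^ 2 ≤ (4 * c ^ 2 * G * ‖x‖) ^ 2 := by
    have he : Real.exp (-1) ^ 2 * Real.exp 1 ^ 2 = 1 := by
      rw [← mul_pow, ← Real.exp_add]; simp
    have he1 : Real.exp 1 ^ 2 ≤ 3 ^ 2 :=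
      pow_le_pow_left₀ (by positivity) (by linarith [Real.exp_one_lt_d9]) 2
    have hmain' : Real.exp (-1) ^ 2 * (‖C (T t x)‖ * t) ^ 2 ≤
        3 / 2 * (c ^ 2 * G * ‖x‖) ^ 2 := by
      rw [div_pow, mul_pow] at hmain
      have hpos : 0 < t / (3 * c ^ 2) := by positivity
      refine le_of_mul_le_mul_left ?_ hpos
      refine (le_of_eq ?_).trans (hmain.trans (le_of_eq ?_)) <;> field_simp
    have := mul_le_mul_of_nonneg_left hmain' (by positivity : (0 : ℝ) ≤ Real.exp 1 ^ 2)
    have h4 : (‖C (T t x)‖ * t) ^ 2 ≤ Real.exp 1 ^ 2 * (3 / 2 * (c ^ 2 * G * ‖x‖) ^ 2) := by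
      refine le_trans (le_of_eq ?_) this
      rw [← mul_assoc, mul_comm (Real.exp 1 ^ 2), he, one_mul]
    nlinarith [sq_nonneg (c ^ 2 * G * ‖x‖)]
  have := abs_le_of_sq_le_sq' hfin (by positivity)
  rw [ContinuousLinearMap.comp_apply, div_mul_eq_mul_div, le_div_iff₀ ht]
  exact this.2

end Hilbert

theorem exists_rpow_mul_abs_log_rpow_le {ε γ : ℝ} (hε : 0 < ε) (hγ : 0 ≤ γ) :
    ∃ B > 0, ∀ ξ : ℝ, 0 < ξ → ξ < 1 → ξ ^ ε * |Real.log ξ| ^ γ ≤ B := by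
  rcases hγ.eq_or_lt with rfl | hγ
  · refine ⟨1, one_pos, fun ξ h0 h1 => ?_⟩
    simpa using Real.rpow_le_one h0.le h1.le hε.le
  · refine ⟨(1 / (ε / γ)) ^ γ, by positivity, fun ξ h0 h1 => ?_⟩
    have h := (Real.abs_log_mul_self_rpow_lt ξ (ε / γ) h0 h1.le (by positivity)).le
    have h2 := Real.rpow_le_rpow (abs_nonneg _) h hγ.le
    rw [abs_mul, Real.mul_rpow (abs_nonneg _) (abs_nonneg _),
      abs_of_nonneg (by positivity : 0 ≤ ξ ^ (ε / γ)), ← Real.rpow_mul h0.le,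
      div_mul_cancel₀ _ hγ.ne'] at h2
    rwa [mul_comm]

/-- Splitting the Laplace transform of `C T` at `N > 1`: uniform bound on `(0, N]`, decay after. -/
theorem norm_comp_resolvent_le_of_decay {X : Type*} [NormedAddCommGroup X] [NormedSpace ℂ X]
    [CompleteSpace X] {T : ℝ → X →L[ℂ] X} {R : ℂ → X →L[ℂ] X} (hT0 : T 0 = 1)
    (hTsemi : ∀ s t : ℝ, 0 ≤ s → 0 ≤ t → T (s + t) = T s ∘L T t)
    (hTcont : ∀ x : X, ContinuousOn (fun t : ℝ => T t x) (Ici 0))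
    {c : ℝ} (hc0 : 0 ≤ c) (hc : ∀ t : ℝ, 0 ≤ t → ‖T t‖ ≤ c)
    (hR : ∀ lam : ℂ, 0 < lam.re → ∀ x, ∃ z, lam • R lam x - z = x ∧
      Tendsto (fun t : ℝ => (t : ℂ)⁻¹ • (T t (R lam x) - R lam x)) (𝓝[>] 0) (𝓝 z))
    (C : X →L[ℂ] X) {β γ M N : ℝ} (hβ1 : β < 1) (hγ : 0 ≤ γ) (hM : 0 ≤ M) (hN : 1 < N)
    (hdecay : ∀ t : ℝ, N < t → ‖C ∘L (T t)‖ ≤ M / (t ^ β * Real.log t ^ γ))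
    {lam : ℂ} (hlam : 0 < lam.re) :
    ‖C ∘L R lam‖ ≤ ‖C‖ * c * N +
      M / Real.log N ^ γ * ((1 / lam.re) ^ (1 - β) * Real.Gamma (1 - β)) := by
  have hN0 : 0 < N := one_pos.trans hN
  have hlogN : 0 < Real.log N := Real.log_pos hN
  have hGam : 0 < Real.Gamma (1 - β) := Real.Gamma_pos_of_pos (by linarith)
  refine ContinuousLinearMap.opNorm_le_bound _ (by positivity) fun x => ?_
  obtain ⟨z, hz, hz'⟩ := hR lam hlam x
  have hlap := integral_exp_smul_semigroup hT0 hTsemi hTcont hc hlam hz'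
  have h_int := integrableOn_pow_smul_semigroup hTcont hc hlam x 0
  simp only [pow_zero, one_smul] at h_int
  rw [hz] at hlap
  rw [ContinuousLinearMap.comp_apply, ← hlap, ← C.integral_comp_comm h_int]
  have hi1 : IntegrableOn ((Ioc 0 N).indicator fun _ : ℝ => ‖C‖ * c * ‖x‖) (Ioi 0) :=
    (((integrable_indicator_iff measurableSet_Ioc).2
      (integrableOn_const measure_Ioc_lt_top.ne))).integrableOn
  have hi2 : IntegrableOn (fun s : ℝ => s ^ (-β) * Real.exp (-(lam.re * s))) (Ioi 0) := by
    have := integrableOn_rpow_mul_exp_neg_mul_rpow (p := 1) (s := -β) (b := lam.re)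
      (by linarith) one_pos hlam
    simpa [neg_mul] using this
  have hv1 : ∫ s in Ioi (0 : ℝ), (Ioc 0 N).indicator (fun _ : ℝ => ‖C‖ * c * ‖x‖) s =
      ‖C‖ * c * ‖x‖ * N := by
    have hsub : Ioc 0 N ⊆ Ioi (0 : ℝ) := Ioc_subset_Ioi_self
    rw [setIntegral_indicator measurableSet_Ioc, inter_eq_right.2 hsub]
    simp [hN0.le, mul_comm]
  have hv2 : ∫ s in Ioi (0 : ℝ), s ^ (-β) * Real.exp (-(lam.re * s)) =
      (1 / lam.re) ^ (1 - β) * Real.Gamma (1 - β) := by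
    rw [← Real.integral_rpow_mul_exp_neg_mul_Ioi (by linarith) hlam]
    ring_nf
  refine (norm_integral_le_of_norm_le
    (hi1.add (hi2.const_mul (M / Real.log N ^ γ * ‖x‖))) ?_).trans (le_of_eq ?_)
  · filter_upwards [ae_restrict_mem measurableSet_Ioi] with s hs
    have hs0 : 0 < s := hs
    have hexp : ‖Complex.exp (-(lam * s))‖ = Real.exp (-(lam.re * s)) := by
      rw [Complex.norm_exp]
      simp
    rw [Pi.add_apply, map_smul, norm_smul, hexp]
    by_cases hsN : s ≤ N
    · rw [indicator_of_mem (show s ∈ Ioc 0 N from ⟨hs0, hsN⟩)]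
      have h1 : ‖C (T s x)‖ ≤ ‖C‖ * c * ‖x‖ := by
        rw [mul_assoc]
        exact C.le_opNorm_of_le ((T s).le_of_opNorm_le (hc s hs0.le) x)
      have h2 : Real.exp (-(lam.re * s)) ≤ 1 :=
        Real.exp_le_one_iff.2 (neg_nonpos.2 (by positivity))
      have h3 : 0 ≤ M / Real.log N ^ γ * ‖x‖ * (s ^ (-β) * Real.exp (-(lam.re * s))) := by
        positivity
      have h4 := mul_le_mul h2 h1 (norm_nonneg _) zero_le_one
      linarith
    · have hsN' : N < s := not_le.1 hsN
      rw [indicator_of_notMem (fun h => hsN h.2), zero_add]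
      have h1 : ‖C (T s x)‖ ≤ M / (s ^ β * Real.log s ^ γ) * ‖x‖ :=
        (C ∘L T s).le_of_opNorm_le (hdecay s hsN') x
      have h2 : M / (s ^ β * Real.log s ^ γ) ≤ M / Real.log N ^ γ * s ^ (-β) := by
        rw [Real.rpow_neg hs0.le, ← div_eq_mul_inv, div_div, mul_comm (s ^ β)]
        gcongr
      calc Real.exp (-(lam.re * s)) * ‖C (T s x)‖
          ≤ Real.exp (-(lam.re * s)) * (M / Real.log N ^ γ * s ^ (-β) * ‖x‖) := by
            gcongr
            exact h1.trans (by gcongr)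
        _ = _ := by ring
  · have hadd := integral_add hi1 (hi2.const_mul (M / Real.log N ^ γ * ‖x‖))
    simp only [Pi.add_apply] at hadd ⊢
    rw [hadd, hv1, integral_const_mul, hv2]
    ring


/-- For a bounded C₀-semigroup on a Hilbert space with generator `A` and a
bounded operator `C` commuting with the semigroup, the decay
`‖C T(t)‖ ≤ M/(t^β (log t)^γ)` for large `t` (`0 ≤ β < 1`, `γ ≥ 0`) is equivalent to the
resolvent bound `‖C R(λ,A)‖ ≤ K/((Re λ)^{1-β} |log Re λ|^γ)` for `0 < Re λ < 1`. -/
theorem stmt_17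
    {X : Type*} [NormedAddCommGroup X] [InnerProductSpace ℂ X] [CompleteSpace X]
    (T : ℝ → X →L[ℂ] X)
    (hT0 : T 0 = 1)
    (hTsemi : ∀ s t : ℝ, 0 ≤ s → 0 ≤ t → T (s + t) = T s ∘L T t)
    (hTcont : ∀ x : X, ContinuousOn (fun t : ℝ => T t x) (Set.Ici 0))
    (hTbdd : ∃ c : ℝ, ∀ t : ℝ, 0 ≤ t → ‖T t‖ ≤ c)
    (Dom : Set X) (A : X → X)
    (hgen : ∀ x y, (x ∈ Dom ∧ A x = y) ↔
      Filter.Tendsto (fun t : ℝ => (t : ℂ)⁻¹ • (T t x - x))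
        (nhdsWithin 0 (Set.Ioi 0)) (nhds y))
    (R : ℂ → X →L[ℂ] X)
    (hR₁ : ∀ lam : ℂ, 0 < lam.re → ∀ x, R lam x ∈ Dom ∧ lam • R lam x - A (R lam x) = x)
    (hR₂ : ∀ lam : ℂ, 0 < lam.re → ∀ x ∈ Dom, R lam (lam • x - A x) = x)
    (C : X →L[ℂ] X)
    (hcomm : ∀ t : ℝ, 0 ≤ t → C ∘L (T t) = (T t) ∘L C)
    (β γ : ℝ) (hβ0 : 0 ≤ β) (hβ1 : β < 1) (hγ : 0 ≤ γ) :
    (∃ M > 0, ∃ t₁ > 0, ∀ t : ℝ, t₁ ≤ t →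
        ‖C ∘L (T t)‖ ≤ M / (t ^ β * Real.log t ^ γ))
      ↔ (∃ K > 0, ∀ lam : ℂ, 0 < lam.re → lam.re < 1 →
          ‖C ∘L (R lam)‖ ≤ K / (lam.re ^ (1 - β) * |Real.log lam.re| ^ γ)) := by
  obtain ⟨c₀, hc₀⟩ := hTbdd
  obtain ⟨c, hc0, hc⟩ : ∃ c : ℝ, 0 < c ∧ ∀ t : ℝ, 0 ≤ t → ‖T t‖ ≤ c :=
    ⟨max c₀ 1, by positivity, fun t ht => (hc₀ t ht).trans (le_max_left _ _)⟩
  have hR : ∀ lam : ℂ, 0 < lam.re → ∀ x, ∃ z, lam • R lam x - z = x ∧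
      Tendsto (fun t : ℝ => (t : ℂ)⁻¹ • (T t (R lam x) - R lam x)) (𝓝[>] 0) (𝓝 z) :=
    fun lam hlam x => ⟨A (R lam x), (hR₁ lam hlam x).2,
      (hgen _ _).1 ⟨(hR₁ lam hlam x).1, rfl⟩⟩
  constructor
  · rintro ⟨M, hM, t₁, -, hdecay⟩
    set ε : ℝ := (1 - β) / 2 with hεdef
    have hε : 0 < ε := by linarith
    obtain ⟨B, hB, hBle⟩ := exists_rpow_mul_abs_log_rpow_le hε hγ
    have hGam : 0 < Real.Gamma (1 - β) := Real.Gamma_pos_of_pos (by linarith)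
    refine ⟨‖C‖ * c * max t₁ 1 * B + M / ε ^ γ * Real.Gamma (1 - β), by positivity,
      fun lam h0 h1 => ?_⟩
    set ξ := lam.re
    have hL : 0 < |Real.log ξ| := abs_pos.2 (Real.log_neg h0 h1).ne
    have hpow : 1 < ξ ^ (-ε) := Real.one_lt_rpow_of_pos_of_lt_one_of_neg h0 h1 (by linarith)
    have hmax : 1 ≤ max t₁ 1 := le_max_right _ _
    have hN : 1 < max t₁ 1 * ξ ^ (-ε) :=
      hpow.trans_le (le_mul_of_one_le_left (by positivity) hmax)
    have hNt : t₁ ≤ max t₁ 1 * ξ ^ (-ε) :=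
      (le_max_left _ _).trans (le_mul_of_one_le_right (by positivity) hpow.le)
    refine (norm_comp_resolvent_le_of_decay hT0 hTsemi hTcont hc0.le hc hR C hβ1 hγ hM.le hN
      (fun t ht => hdecay t (hNt.trans ht.le)) h0).trans ?_
    have hlog : ε * |Real.log ξ| ≤ Real.log (max t₁ 1 * ξ ^ (-ε)) := by
      rw [Real.log_mul (by positivity) (by positivity), Real.log_rpow h0,
        abs_of_neg (Real.log_neg h0 h1)]
      linarith [Real.log_nonneg hmax]
    have hlogpow : ε ^ γ * |Real.log ξ| ^ γ ≤ Real.log (max t₁ 1 * ξ ^ (-ε)) ^ γ := by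
      rw [← Real.mul_rpow hε.le hL.le]
      exact Real.rpow_le_rpow (by positivity) hlog hγ
    have hsplit : ξ ^ (1 - β) = ξ ^ ε * ξ ^ ε := by
      rw [← Real.rpow_add h0]
      congr 1
      rw [hεdef]
      ring
    rw [add_div]
    refine add_le_add ?_ ?_
    · rw [Real.rpow_neg h0.le, hsplit, le_div_iff₀ (by positivity)]
      calc ‖C‖ * c * (max t₁ 1 * (ξ ^ ε)⁻¹) * (ξ ^ ε * ξ ^ ε * |Real.log ξ| ^ γ)
          = ‖C‖ * c * max t₁ 1 * (ξ ^ ε * |Real.log ξ| ^ γ) := by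
            field_simp
        _ ≤ ‖C‖ * c * max t₁ 1 * B := by
            gcongr
            exact hBle ξ h0 h1
    · rw [Real.div_rpow zero_le_one h0.le, Real.one_rpow]
      calc M / Real.log (max t₁ 1 * ξ ^ (-ε)) ^ γ * (1 / ξ ^ (1 - β) * Real.Gamma (1 - β))
          ≤ M / (ε ^ γ * |Real.log ξ| ^ γ) * (1 / ξ ^ (1 - β) * Real.Gamma (1 - β)) := by
            gcongr
        _ = _ := by
            field_simp
  · rintro ⟨K, hK, hres⟩
    refine ⟨4 * c ^ 2 * K, by positivity, 2, two_pos, fun t ht => ?_⟩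
    have ht0 : 0 < t := by linarith
    have hlt : t⁻¹ < 1 := inv_lt_one_of_one_lt₀ (by linarith)
    have hlog : 0 < Real.log t := Real.log_pos (by linarith)
    have hG : ∀ lam : ℂ, lam.re = t⁻¹ →
        ‖C ∘L R lam‖ ≤ K / (t⁻¹ ^ (1 - β) * |Real.log t⁻¹| ^ γ) := fun lam hlam => by
      rw [← hlam]
      exact hres lam (hlam ▸ inv_pos.2 ht0) (hlam ▸ hlt)
    refine (norm_comp_semigroup_le_of_resolvent_le hT0 hTsemi hTcont hc0 hc hR C hcomm ht0
      hG).trans (le_of_eq ?_)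
    rw [Real.log_inv, abs_neg, abs_of_pos hlog, Real.inv_rpow ht0.le, Real.rpow_sub ht0,
      Real.rpow_one]
    field_simp
end

section
/- Let (T(t))_{t≥0} be a polynomially stable C₀-semigroup on a complex Hilbert space X with generator A, i.e., (T(t))_{t≥0} is bounded and there exists α > 0 with ‖T(t)(I−A)⁻¹‖ = O(t^{-1/α}) as t → ∞. Let C : D(A) → X be a linear map for which there exists c₀ > 0 with ‖Cx‖ ≤ c₀(‖x‖ + ‖Ax‖) for all x ∈ D(A), such that T(t)Cx = C T(t)x for all x ∈ D(A) and t ≥ 0. Assume there exist an integer n ≥ 1 and a linear map C̃ : D(A) → X with ‖C̃ x‖ ≤ c₁(‖x‖ + ‖Ax‖) for all x ∈ D(A) and some c₁ > 0, such that C̃ x = (−1)ⁿ C(Aⁿ x) for all x ∈ D(A^{n+1}), and a constant K > 0 with ‖C̃ R(λ,A) x‖ ≤ K ‖x‖ / √(Re λ) for all λ with Re λ > 0 and all x ∈ X. Then there exist M > 0 and β' > 0 such that ‖C T(t) x‖ ≤ M t^{-(1+β')/2} ‖x‖ for all t > 0 and x ∈ D(A); in particular, for each t > 0 the map x ↦ C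 T(t)x extends to a bounded linear operator on X of norm at most M/√(t^{1+β'}). (Integer-exponent case of the paper's proposition that the strong 2-Weiss condition implies the improved decay rate ‖CT(t)‖ = O(1/√(t^{1+β'})).) -/
/-- Domain of the `k`-th power of an (unbounded) operator `A` with domain `D`:
`iterDom D A 0 = X` and `iterDom D A (k+1) = {x ∈ D | A x ∈ iterDom D A k}`. -/
def iterDom {X : Type*} (D : Set X) (A : X → X) : ℕ → Set X
  | 0 => Set.univ
  | k + 1 => {x ∈ D | A x ∈ iterDom D A k}

open Filter Topology Set

theorem sum_norm_sq_dft {X : Type*} [NormedAddCommGroup X] [InnerProductSpace ℂ X]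
    {L : ℕ} {ω : ℂ} (hω : IsPrimitiveRoot ω L) (hL : L ≠ 0) (v : ℕ → X) :
    ∑ j ∈ Finset.range L, ‖∑ k ∈ Finset.range L, ω ^ (j * k) • v k‖ ^ 2 =
      L * ∑ k ∈ Finset.range L, ‖v k‖ ^ 2 := by
  have hn : ‖ω‖ = 1 := hω.norm'_eq_one hL
  have hω0 : ω ≠ 0 := by intro h; simp [h] at hn
  have hconj : (starRingEnd ℂ) ω = ω⁻¹ := (Complex.inv_eq_conj hn).symm
  have orth : ∀ k ∈ Finset.range L, ∀ l ∈ Finset.range L,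
      ∑ j ∈ Finset.range L, (ω⁻¹ ^ (j * k) * ω ^ (j * l)) = if k = l then (L : ℂ) else 0 := by
    intro k hk l hl
    rw [Finset.mem_range] at hk hl
    have e : ∀ j, ω⁻¹ ^ (j * k) * ω ^ (j * l) = (ω⁻¹ ^ k * ω ^ l) ^ j := by
      intro j; rw [mul_pow, ← pow_mul, ← pow_mul, mul_comm j k, mul_comm j l]
    simp_rw [e]
    split_ifs with hkl
    · subst hkl
      simp [hω0]
    · have hne : ω⁻¹ ^ k * ω ^ l ≠ 1 := by
        intro h
        rw [inv_pow, inv_mul_eq_one₀ (pow_ne_zero _ hω0)] at h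
        exact hkl (hω.pow_inj hk hl h)
      have h1 : (ω⁻¹ ^ k * ω ^ l) ^ L = 1 := by
        rw [mul_pow, ← pow_mul, ← pow_mul, mul_comm k, mul_comm l, pow_mul, pow_mul, inv_pow,
          hω.pow_eq_one]; simp
      rw [geom_sum_eq hne, h1]; simp
  have key : ∑ j ∈ Finset.range L, ((‖∑ k ∈ Finset.range L, ω ^ (j * k) • v k‖ : ℂ)) ^ 2 =
      L * ∑ k ∈ Finset.range L, ((‖v k‖ : ℂ)) ^ 2 := by
    calc _ = ∑ j ∈ Finset.range L, ∑ k ∈ Finset.range L, ∑ l ∈ Finset.range L,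
          (ω⁻¹ ^ (j * k) * ω ^ (j * l)) * inner ℂ (v k) (v l) := by
            refine Finset.sum_congr rfl fun j _ => ?_
            have := inner_self_eq_norm_sq_to_K (𝕜 := ℂ) (∑ k ∈ Finset.range L, ω ^ (j * k) • v k)
            simp only [Complex.coe_algebraMap] at this
            rw [← this, sum_inner]
            refine Finset.sum_congr rfl fun k _ => ?_
            rw [inner_sum]
            refine Finset.sum_congr rfl fun l _ => ?_
            rw [inner_smul_left, inner_smul_right, map_pow, hconj]; ring
      _ = ∑ k ∈ Finset.range L, ∑ l ∈ Finset.range L,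
          (if k = l then (L : ℂ) else 0) * inner ℂ (v k) (v l) := by
            rw [Finset.sum_comm]
            refine Finset.sum_congr rfl fun k hk => ?_
            rw [Finset.sum_comm]
            refine Finset.sum_congr rfl fun l hl => ?_
            rw [← Finset.sum_mul, orth k hk l hl]
      _ = _ := by
            rw [Finset.mul_sum]
            refine Finset.sum_congr rfl fun k hk => ?_
            have := inner_self_eq_norm_sq_to_K (𝕜 := ℂ) (v k)
            simp only [Complex.coe_algebraMap] at this
            simp [Finset.mem_range.1 hk]
  exact_mod_cast key

/-- `y` is the value at `x` of the generator. -/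
def HasGenAt {X : Type*} [NormedAddCommGroup X] [NormedSpace ℂ X]
    (T : ℝ → X →L[ℂ] X) (x y : X) : Prop :=
  Tendsto (fun t : ℝ => (t : ℂ)⁻¹ • (T t x - x)) (𝓝[>] 0) (𝓝 y)

structure IsBddSemigroup {X : Type*} [NormedAddCommGroup X] [NormedSpace ℂ X]
    (T : ℝ → X →L[ℂ] X) (c : ℝ) : Prop where
  zero : T 0 = 1
  add : ∀ s t : ℝ, 0 ≤ s → 0 ≤ t → T (s + t) = T s * T t
  cont : ∀ x : X, ContinuousOn (fun t : ℝ => T t x) (Ici 0)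
  bound : ∀ t : ℝ, 0 ≤ t → ‖T t‖ ≤ c

structure IsResolventAt {X : Type*} [NormedAddCommGroup X] [NormedSpace ℂ X]
    (T : ℝ → X →L[ℂ] X) (μ : ℂ) (R : X →L[ℂ] X) : Prop where
  hasGenAt : ∀ x, HasGenAt T (R x) (μ • R x - x)
  left_inv : ∀ x y, HasGenAt T x y → R (μ • x - y) = x

section
variable {X : Type*} [NormedAddCommGroup X] [NormedSpace ℂ X] {T : ℝ → X →L[ℂ] X} {c : ℝ}

theorem HasGenAt.map {x y : X} (h : HasGenAt T x y) (W : X →L[ℂ] X)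
    (hW : ∀ t, 0 ≤ t → Commute (T t) W) : HasGenAt T (W x) (W y) := by
  have := (W.continuous.tendsto y).comp h
  refine this.congr' ?_
  filter_upwards [self_mem_nhdsWithin] with t ht
  have e : T t (W x) = W (T t x) := DFunLike.congr_fun (hW t (le_of_lt ht)).eq x
  simp [e]

theorem HasGenAt.hasDerivWithinAt (hT : IsBddSemigroup T c) {x y : X} (h : HasGenAt T x y) {s : ℝ}
    (hs : 0 ≤ s) : HasDerivWithinAt (fun u => T u x) (T s y) (Ici s) s := by
  rw [hasDerivWithinAt_iff_tendsto_slope]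
  have h1 : Tendsto (fun u : ℝ => u - s) (𝓝[>] s) (𝓝[>] 0) := by
    refine tendsto_nhdsWithin_iff.2 ⟨?_, ?_⟩
    · have : Tendsto (fun u : ℝ => u - s) (𝓝 s) (𝓝 (s - s)) := by
        apply Continuous.tendsto; fun_prop
      rw [sub_self] at this
      exact this.mono_left nhdsWithin_le_nhds
    · filter_upwards [self_mem_nhdsWithin] with u hu
      exact sub_pos.2 (mem_Ioi.1 hu)
  have h2 := ((T s).continuous.tendsto y).comp (Tendsto.comp h h1)
  rw [Ici_sdiff_left]
  refine h2.congr' ?_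
  filter_upwards [self_mem_nhdsWithin] with u hu
  have e : T u = T s * T (u - s) := by
    rw [← hT.add s (u - s) hs (sub_nonneg.2 (le_of_lt hu))]; congr 1; ring
  have : ((u - s : ℝ) : ℂ)⁻¹ = (((u - s)⁻¹ : ℝ) : ℂ) := by push_cast; ring
  simp only [Function.comp_apply, slope, vsub_eq_sub, this, Complex.coe_smul]
  rw [ContinuousLinearMap.map_smul_of_tower, e]
  simp

theorem IsResolventAt.commute {μ : ℂ} {R : X →L[ℂ] X} (hR : IsResolventAt T μ R) {W : X →L[ℂ] X}
    (hW : ∀ t, 0 ≤ t → Commute (T t) W) : Commute R W := by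
  refine ContinuousLinearMap.ext fun x => ?_
  have := hR.left_inv _ _ ((hR.hasGenAt x).map W hW)
  simpa using this

theorem IsResolventAt.commute_semigroup (hT : IsBddSemigroup T c) {μ : ℂ} {R : X →L[ℂ] X}
    (hR : IsResolventAt T μ R) {t : ℝ} (ht : 0 ≤ t) : Commute (T t) R :=
  (hR.commute fun s hs => by
    rw [Commute, SemiconjBy, ← hT.add s t hs ht, ← hT.add t s ht hs, add_comm]).symm

theorem IsResolventAt.eq_mul {μ ν : ℂ} {R S : X →L[ℂ] X} (hR : IsResolventAt T μ R)
    (hS : IsResolventAt T ν S) : R = S * (1 - (μ - ν) • R) := by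
  ext x
  have := hS.left_inv _ _ (hR.hasGenAt x)
  calc R x = S (ν • R x - (μ • R x - x)) := this.symm
    _ = S (x - (μ - ν) • R x) := by congr 1; module
    _ = _ := rfl

theorem HasGenAt.norm_sub_le (hT : IsBddSemigroup T c) {x y : X} (h : HasGenAt T x y) {t : ℝ}
    (ht : 0 ≤ t) : ‖T t x - x‖ ≤ c * ‖y‖ * t := by
  refine image_norm_le_of_norm_deriv_right_le_deriv_boundary (a := 0) (b := t)
    (f := fun t => T t x - x) (f' := fun s => T s y)
    (B := fun s => c * ‖y‖ * s) (B' := fun _ => c * ‖y‖) ?_ ?_ ?_ ?_ ?_ ⟨ht, le_rfl⟩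
  · exact ((hT.cont x).mono Icc_subset_Ici_self).sub continuousOn_const
  · intro s hs
    exact (h.hasDerivWithinAt hT hs.1).sub_const _
  · simp [hT.zero]
  · intro s
    simpa using (hasDerivAt_id s).const_mul (c * ‖y‖)
  · intro s hs
    exact (T s).le_of_opNorm_le (hT.bound s hs.1) y

theorem HasGenAt.norm_sub_sub_le (hT : IsBddSemigroup T c) {x y z : X} (h : HasGenAt T x y)
    (h' : HasGenAt T y z) {t : ℝ} (ht : 0 ≤ t) : ‖T t x - x - t • y‖ ≤ c * ‖z‖ * t ^ 2 / 2 := by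
  refine image_norm_le_of_norm_deriv_right_le_deriv_boundary (a := 0) (b := t)
    (f := fun t => T t x - x - t • y) (f' := fun s => T s y - y)
    (B := fun s => c * ‖z‖ * s ^ 2 / 2) (B' := fun s => c * ‖z‖ * s) ?_ ?_ ?_ ?_ ?_ ⟨ht, le_rfl⟩
  · exact (((hT.cont x).mono Icc_subset_Ici_self).sub continuousOn_const).sub (by fun_prop)
  · intro s hs
    have := ((hasDerivAt_id s).smul_const y).hasDerivWithinAt (s := Ici s)
    rw [one_smul] at this
    exact ((h.hasDerivWithinAt hT hs.1).sub_const _).sub this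
  · simp [hT.zero]
  · intro s
    exact (((hasDerivAt_pow 2 s).const_mul (c * ‖z‖)).div_const 2).congr_deriv (by
      push_cast; ring)
  · intro s hs
    exact h'.norm_sub_le hT hs.1

theorem IsResolventAt.norm_semigroup_le (hT : IsBddSemigroup T c) {μ : ℝ} (hμ : 0 < μ)
    {R : X →L[ℂ] X} (hR : IsResolventAt T μ R) {y : X} {B : ℝ}
    (hB : ∀ u, 0 ≤ u → ‖T u y‖ ≤ B) {u : ℝ} (hu : 0 ≤ u) : ‖T u (((μ : ℂ) • R) y)‖ ≤ B := by
  set x := ((μ : ℂ) • R) y with hx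
  have hgx : HasGenAt T x (μ • x - μ • y) := by
    have := (hR.hasGenAt y).map ((μ : ℂ) • 1) (fun t _ => (Commute.one_right _).smul_right _)
    have e : μ • x - μ • y = ((μ : ℂ) • (1 : X →L[ℂ] X)) ((μ : ℂ) • R y - y) := by
      change _ = (μ : ℂ) • ((μ : ℂ) • R y - y)
      rw [smul_sub]
      rfl
    rw [e]
    exact this
  have hgu : HasGenAt T (T u x) (T u (μ • x - μ • y)) := hgx.map (T u) fun s hs => by
    rw [Commute, SemiconjBy, ← hT.add s u hs hu, ← hT.add u s hu hs, add_comm]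
  have main : ∀ t, 0 ≤ t → ‖T u x‖ ≤ B * (1 - Real.exp (-μ * t)) +
      Real.exp (-μ * t) * (c * ‖T u x‖) := by
    intro t ht
    have hd : ∀ s, HasDerivAt (fun s => Real.exp (-μ * s)) (-μ * Real.exp (-μ * s)) s := by
      intro s
      have := ((hasDerivAt_id s).const_mul (-μ)).exp
      simpa [mul_comm] using this
    have : ‖Real.exp (-μ * t) • T t (T u x) - T u x‖ ≤ B * (1 - Real.exp (-μ * t)) := by
      refine image_norm_le_of_norm_deriv_right_le_deriv_boundary (a := 0) (b := t)
        (f := fun t => Real.exp (-μ * t) • T t (T u x) - T u x)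
        (f' := fun s => Real.exp (-μ * s) • T s (T u (μ • x - μ • y)) +
          (-μ * Real.exp (-μ * s)) • T s (T u x))
        (B := fun s => B * (1 - Real.exp (-μ * s)))
        (B' := fun s => B * (-(-μ * Real.exp (-μ * s)))) ?_ ?_ ?_ ?_ ?_ ⟨ht, le_rfl⟩
      · refine ContinuousOn.sub (ContinuousOn.smul (f := fun t => Real.exp (-μ * t))
          (by fun_prop) ?_) continuousOn_const
        exact ((hT.cont _).mono Icc_subset_Ici_self)
      · intro s hs
        exact ((hd s).hasDerivWithinAt.smul (hgu.hasDerivWithinAt hT hs.1)).sub_const _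
      · simp [hT.zero]
      · intro s
        exact ((hd s).const_sub 1).const_mul B
      · intro s hs
        have e : Real.exp (-μ * s) • T s (T u (μ • x - μ • y)) +
          (-μ * Real.exp (-μ * s)) • T s (T u x) = (-(μ * Real.exp (-μ * s))) • T (s + u) y := by
          rw [hT.add s u hs.1 hu]
          simp only [map_sub, ContinuousLinearMap.map_smul_of_tower, mul_apply_eq_comp]
          rw [smul_sub, smul_smul, smul_smul, neg_mul, mul_comm μ]
          module
        rw [e, norm_smul, norm_neg, Real.norm_of_nonneg (by positivity)]
        have := hB (s + u) (add_nonneg hs.1 hu)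
        have h0 : 0 ≤ μ * Real.exp (-μ * s) := by positivity
        nlinarith
    have h2 : ‖Real.exp (-μ * t) • T t (T u x)‖ ≤ Real.exp (-μ * t) * (c * ‖T u x‖) := by
      rw [norm_smul, Real.norm_of_nonneg (Real.exp_pos _).le]
      gcongr
      exact (T t).le_of_opNorm_le (hT.bound t ht) _
    have h3 := norm_sub_le (Real.exp (-μ * t) • T t (T u x))
      (Real.exp (-μ * t) • T t (T u x) - T u x)
    rw [sub_sub_cancel] at h3
    linarith
  have hlim : Tendsto (fun t => B * (1 - Real.exp (-μ * t)) +
      Real.exp (-μ * t) * (c * ‖T u x‖)) atTop (𝓝 (B * (1 - 0) + 0 * (c * ‖T u x‖))) := by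
    have he : Tendsto (fun t => Real.exp (-μ * t)) atTop (𝓝 0) :=
      Real.tendsto_exp_atBot.comp (tendsto_id.const_mul_atTop_of_neg (neg_lt_zero.2 hμ))
    exact ((he.const_sub 1).const_mul B).add (he.mul_const _)
  have := ge_of_tendsto hlim (by filter_upwards [eventually_ge_atTop 0] with t ht using main t ht)
  simpa using this

theorem IsResolventAt.norm_pow_le (hT : IsBddSemigroup T c) {μ : ℝ} (hμ : 0 < μ)
    {R : X →L[ℂ] X} (hR : IsResolventAt T μ R) (k : ℕ) : ‖((μ : ℂ) • R) ^ k‖ ≤ c := by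
  have hc : 0 ≤ c := (norm_nonneg _).trans (hT.bound 0 le_rfl)
  refine ContinuousLinearMap.opNorm_le_bound _ hc fun y => ?_
  have : ∀ u, 0 ≤ u → ‖T u ((((μ : ℂ) • R) ^ k) y)‖ ≤ c * ‖y‖ := by
    induction k with
    | zero => intro u hu; exact (T u).le_of_opNorm_le (hT.bound u hu) y
    | succ k ih =>
      intro u hu
      rw [pow_succ']
      exact hR.norm_semigroup_le hT hμ ih hu
  simpa [hT.zero] using this 0 le_rfl

theorem IsBddSemigroup.pow (hT : IsBddSemigroup T c) {h : ℝ} (hh : 0 ≤ h) (k : ℕ) :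
    T h ^ k = T (k * h) := by
  induction k with
  | zero => simp [hT.zero]
  | succ k ih => rw [pow_succ, ih, ← hT.add _ _ (by positivity) hh]; congr 1; push_cast; ring

/-- Quantitative implicit Euler approximation of the semigroup on the domain of `A²`. -/
theorem IsResolventAt.norm_sub_pow_le (hT : IsBddSemigroup T c) {h : ℝ} (hh : 0 < h)
    {R : X →L[ℂ] X} (hR : IsResolventAt T (h⁻¹ : ℝ) R) {x y z : X} (hxy : HasGenAt T x y)
    (hyz : HasGenAt T y z) (N : ℕ) :
    ‖T (N * h) x - ((((h⁻¹ : ℝ) : ℂ) • R) ^ N) x‖ ≤ N * (c * c) * (2 * c * ‖z‖ * h ^ 2) := by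
  have hc : 0 ≤ c := (norm_nonneg _).trans (hT.bound 0 le_rfl)
  have hpow := hR.norm_pow_le hT (inv_pos.2 hh)
  set S := ((h⁻¹ : ℝ) : ℂ) • R with hS
  have hRS : ∀ w, R w = h • S w := by
    intro w
    simp only [hS, smul_apply, Complex.coe_smul]
    rw [smul_smul, mul_inv_cancel₀ hh.ne', one_smul]
  have step : ∀ {x y : X}, HasGenAt T x y → S x = x + h • S y := by
    intro x y hxy
    have := hR.left_inv _ _ hxy
    rw [map_sub, map_smul] at this
    have e : S x = ((h⁻¹ : ℝ) : ℂ) • R x := rfl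
    rw [e, ← hRS, ← sub_eq_iff_eq_add, this]
  have hS1 : ‖S z‖ ≤ c * ‖z‖ := by
    have := hpow 1
    rw [pow_one] at this
    exact S.le_of_opNorm_le this z
  have hloc : ‖(T h - S) x‖ ≤ 2 * c * ‖z‖ * h ^ 2 := by
    have e : (T h - S) x = (T h x - x - h • y) - h ^ 2 • S z := by
      rw [sub_apply, step hxy, step hyz]
      module
    rw [e]
    refine (norm_sub_le _ _).trans ?_
    have h1 := hxy.norm_sub_sub_le hT hyz hh.le
    have h2 : ‖h ^ 2 • S z‖ ≤ h ^ 2 * (c * ‖z‖) := by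
      rw [norm_smul, Real.norm_of_nonneg (by positivity)]; gcongr
    have h3 : 0 ≤ c * ‖z‖ * h ^ 2 := by positivity
    linarith
  have hcomm : Commute (T h) S := (hR.commute_semigroup hT hh.le).smul_right _
  have e : T (N * h) x - (S ^ N) x =
      (∑ i ∈ Finset.range N, T h ^ i * S ^ (N - 1 - i)) ((T h - S) x) := by
    rw [← mul_apply_eq_comp, hcomm.geom_sum₂_mul, hT.pow hh.le]; rfl
  rw [e]
  refine (ContinuousLinearMap.le_opNorm _ _).trans ?_
  gcongr
  refine (norm_sum_le _ _).trans ?_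
  refine (Finset.sum_le_card_nsmul _ _ (c * c) fun i _ => ?_).trans (by simp)
  refine (norm_mul_le _ _).trans ?_
  gcongr
  · rw [hT.pow hh.le]; exact hT.bound _ (by positivity)
  · exact hpow _

end

theorem IsResolventAt.denseRange {X : Type*} [NormedAddCommGroup X] [NormedSpace ℂ X]
    [CompleteSpace X] {T : ℝ → X →L[ℂ] X} {c : ℝ} (hT : IsBddSemigroup T c) {μ : ℂ}
    {R : X →L[ℂ] X} (hR : IsResolventAt T μ R) : DenseRange R := by
  intro x
  set f : ℝ → X := fun s => T (max s 0) x with hf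
  have hfc : Continuous f :=
    (hT.cont x).comp_continuous (by fun_prop) (fun s => le_max_right s 0)
  have hfT : ∀ s, 0 ≤ s → f s = T s x := fun s hs => by simp [hf, max_eq_left hs]
  set G : ℝ → X := fun u => ∫ s in (0 : ℝ)..u, f s with hG
  have hGd : ∀ u, HasDerivAt G (f u) u := fun u =>
    intervalIntegral.integral_hasDerivAt_right (hfc.intervalIntegrable _ _)
      (hfc.stronglyMeasurableAtFilter _ _) hfc.continuousAt
  have hG0 : G 0 = 0 := by simp [hG]
  have slope_tendsto : ∀ u, Tendsto (fun t : ℝ => t⁻¹ • (G (u + t) - G u)) (𝓝[>] 0) (𝓝 (f u)) :=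
    fun u => (hGd u).tendsto_slope_zero_right
  have shift : ∀ h t, 0 ≤ h → 0 ≤ t → T t (G h) = G (h + t) - G t := by
    intro h t hh ht
    have h1 : T t (G h) = ∫ s in (0 : ℝ)..h, f (s + t) := by
      rw [hG, ← ContinuousLinearMap.intervalIntegral_comp_comm _ (hfc.intervalIntegrable _ _)]
      refine intervalIntegral.integral_congr fun s hs => ?_
      rw [uIcc_of_le hh] at hs
      change T t (f s) = f (s + t)
      rw [hfT _ hs.1, hfT _ (add_nonneg hs.1 ht), add_comm, hT.add t s ht hs.1]
      rfl
    rw [h1, intervalIntegral.integral_comp_add_right, zero_add,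
      ← intervalIntegral.integral_interval_sub_left (a := 0) (hfc.intervalIntegrable _ _)
        (hfc.intervalIntegrable _ _)]
  have gen : ∀ h, 0 ≤ h → HasGenAt T (G h) (T h x - x) := by
    intro h hh
    have h2 := (slope_tendsto h).sub (slope_tendsto 0)
    rw [hfT h hh, hfT 0 le_rfl, hT.zero] at h2
    refine h2.congr' ?_
    filter_upwards [self_mem_nhdsWithin] with t ht
    rw [shift h t hh (le_of_lt ht), ← smul_sub, ← Complex.coe_smul, hG0, zero_add]
    push_cast
    congr 1
    abel
  have hlim : Tendsto (fun h : ℝ => h⁻¹ • G h) (𝓝[>] 0) (𝓝 x) := by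
    have := slope_tendsto 0
    rw [hfT 0 le_rfl, hT.zero] at this
    simpa [hG0] using this
  refine mem_closure_of_tendsto hlim ?_
  filter_upwards [self_mem_nhdsWithin] with h hh
  have := hR.left_inv _ _ (gen h (le_of_lt hh))
  exact ⟨h⁻¹ • (μ • G h - (T h x - x)), by rw [ContinuousLinearMap.map_smul_of_tower, this]⟩

/-- The coefficients of `(1 + x + ⋯ + x ^ (N - 1)) ^ 2`. -/
def triangleCoeff (N m : ℕ) : ℕ :=
  ((Finset.range N ×ˢ Finset.range N).filter fun p => p.1 + p.2 = m).card

theorem geom_sum_mul_self {R : Type*} [Ring R] (a : R) (N : ℕ) :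
    (∑ k ∈ Finset.range N, a ^ k) * (∑ k ∈ Finset.range N, a ^ k) =
      ∑ m ∈ Finset.range (2 * N), triangleCoeff N m • a ^ m := by
  rw [Finset.sum_mul_sum, ← Finset.sum_product',
    ← Finset.sum_fiberwise_of_maps_to (t := Finset.range (2 * N)) (g := fun p => p.1 + p.2)]
  · refine Finset.sum_congr rfl fun m _ => ?_
    rw [triangleCoeff, ← Finset.sum_const]
    refine Finset.sum_congr rfl fun p hp => ?_
    rw [← pow_add, (Finset.mem_filter.1 hp).2]
  · intro p hp
    simp only [Finset.mem_product, Finset.mem_range] at hp ⊢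
    omega

theorem succ_le_triangleCoeff {N m : ℕ} (h : m < N) : m + 1 ≤ triangleCoeff N m := by
  rw [← Finset.Nat.card_antidiagonal m, triangleCoeff]
  refine Finset.card_le_card fun p hp => ?_
  have := Finset.HasAntidiagonal.mem_antidiagonal.1 hp
  simp only [Finset.mem_filter, Finset.mem_product, Finset.mem_range]
  omega

theorem cube_div_three_le_sum_sq (N : ℕ) :
    (N : ℝ) ^ 3 / 3 ≤ ∑ m ∈ Finset.range N, ((m : ℝ) + 1) ^ 2 := by
  induction N with
  | zero => simp
  | succ N ih =>
    rw [Finset.sum_range_succ]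
    push_cast
    have : (0 : ℝ) ≤ N := by positivity
    nlinarith

/-- Parseval-based decay estimate for powers of a power bounded operator `S = λ R(λ, A)` under a
Weiss-type resolvent condition. -/
theorem norm_sq_apply_pow_le {X : Type*} [NormedAddCommGroup X] [InnerProductSpace ℂ X]
    {Q S R H : X →L[ℂ] X} {μ K c : ℝ} (hμ : 0 < μ) (hK : 0 ≤ K) (hS : S = (μ : ℂ) • R)
    (hpow : ∀ k, ‖S ^ k‖ ≤ c) (hQ : Commute Q S) (hH : Commute H S)
    (hW : ∀ z : ℂ, ‖z‖ < 1 → ∃ R' : X →L[ℂ] X, R = R' * (1 - z • S) ∧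
      ∀ v, ‖Q (R' v)‖ ≤ K * ‖H v‖ / √(μ * (1 - ‖z‖)))
    {N : ℕ} (hN : 1 ≤ N) (v : X) :
    ‖Q ((S ^ N) v)‖ ^ 2 ≤ 24 * c ^ 4 * (1 + c) ^ 2 * K ^ 2 * (μ / N) * ‖H v‖ ^ 2 := by
  have hc : 0 ≤ c := (norm_nonneg _).trans (hpow 0)
  have hN' : (1 : ℝ) ≤ N := by exact_mod_cast hN
  have hN0 : (0 : ℝ) < N := by linarith
  set r : ℝ := 1 - 1 / (4 * N) with hr
  have hr1 : 1 - r = 1 / (4 * N) := by rw [hr]; ring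
  have hdiv : 1 / (4 * (N : ℝ)) ≤ 1 / 4 := by
    rw [div_le_div_iff₀ (by positivity) (by positivity)]; linarith
  have hdiv0 : 0 < 1 / (4 * (N : ℝ)) := by positivity
  have hr0 : 0 ≤ r := by linarith
  have hrlt : r < 1 := by linarith
  have h2N : 2 * N ≠ 0 := by omega
  obtain ⟨ω, hω⟩ : ∃ ω : ℂ, IsPrimitiveRoot ω (2 * N) :=
    ⟨_, Complex.isPrimitiveRoot_exp (2 * N) h2N⟩
  have hωn : ‖ω‖ = 1 := hω.norm'_eq_one h2N
  set z : ℕ → ℂ := fun j => (r : ℂ) * ω ^ j with hz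
  have hzn : ∀ j, ‖z j‖ = r := fun j => by simp [hz, hωn, abs_of_nonneg hr0]
  have hzpow : ∀ j k, z j ^ k = ω ^ (j * k) * ((r ^ k : ℝ) : ℂ) := fun j k => by
    simp only [hz]; push_cast; rw [mul_pow, ← pow_mul]; ring
  set P : ℕ → X →L[ℂ] X := fun j => ∑ k ∈ Finset.range N, (z j • S) ^ k with hP
  have hPS : ∀ j (W : X →L[ℂ] X), Commute W S → Commute W (P j) := fun j W h =>
    Commute.sum_right _ _ _ fun k _ => (h.smul_right _).pow_right _
  -- the Weiss condition on the circle of radius `r`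
  have step1 : ∀ j, ‖Q (R (P j (P j v)))‖ ^ 2 ≤
      K ^ 2 * (1 + c) ^ 2 * (4 * N / μ) * ‖P j (H v)‖ ^ 2 := by
    intro j
    obtain ⟨R', hR', hWR⟩ := hW (z j) (by rw [hzn]; exact hrlt)
    have e1 : (1 - z j • S) * P j = 1 - (z j • S) ^ N := by
      rw [((hPS j _ ((Commute.one_left S).sub_left ((Commute.refl S).smul_left _)))).eq]
      exact geom_sum_mul_neg _ _
    have e2 : R (P j (P j v)) = R' ((1 - (z j • S) ^ N) (P j v)) := by
      calc R (P j (P j v)) = (R' * (1 - z j • S)) (P j (P j v)) := by rw [← hR']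
        _ = R' (((1 - z j • S) * P j) (P j v)) := rfl
        _ = _ := by rw [e1]
    have e3 : H ((1 - (z j • S) ^ N) (P j v)) = (1 - (z j • S) ^ N) (P j (H v)) := by
      have : Commute H ((1 - (z j • S) ^ N) * P j) :=
        ((Commute.one_right H).sub_right ((hH.smul_right _).pow_right _)).mul_right (hPS j H hH)
      exact DFunLike.congr_fun this.eq v
    have e4 : ‖H ((1 - (z j • S) ^ N) (P j v))‖ ≤ (1 + c) * ‖P j (H v)‖ := by
      rw [e3]
      have : (1 - (z j • S) ^ N) (P j (H v)) = P j (H v) - z j ^ N • (S ^ N) (P j (H v)) := by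
        rw [smul_pow]; rfl
      rw [this]
      refine (norm_sub_le _ _).trans ?_
      have h1 : ‖z j ^ N • (S ^ N) (P j (H v))‖ ≤ 1 * (c * ‖P j (H v)‖) := by
        rw [norm_smul, norm_pow, hzn]
        gcongr
        · exact pow_le_one₀ hr0 hrlt.le
        · exact (S ^ N).le_of_opNorm_le (hpow N) _
      linarith
    have h5 := hWR ((1 - (z j • S) ^ N) (P j v))
    rw [← e2, hzn, hr1] at h5
    have h6 : ‖Q (R (P j (P j v)))‖ ≤ K * ((1 + c) * ‖P j (H v)‖) / √(μ * (1 / (4 * N))) := by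
      refine h5.trans ?_
      gcongr
    calc ‖Q (R (P j (P j v)))‖ ^ 2
        ≤ (K * ((1 + c) * ‖P j (H v)‖) / √(μ * (1 / (4 * N)))) ^ 2 := by gcongr
      _ = _ := by
        rw [div_pow, Real.sq_sqrt (by positivity)]
        field_simp
  have step2 : ∑ j ∈ Finset.range (2 * N), ‖P j (H v)‖ ^ 2 ≤ 2 * N * (N * (c * ‖H v‖) ^ 2) := by
    have e : ∀ j, P j (H v) = ∑ k ∈ Finset.range (2 * N), ω ^ (j * k) •
        (if k < N then ((r ^ k : ℝ) : ℂ) • (S ^ k) (H v) else 0) := by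
      intro j
      rw [← Finset.sum_subset (Finset.range_subset_range.2 (by omega : N ≤ 2 * N))]
      · simp only [hP, sum_apply]
        refine Finset.sum_congr rfl fun k hk => ?_
        rw [if_pos (Finset.mem_range.1 hk), smul_smul, ← hzpow, smul_pow]
        rfl
      · intro k _ hk
        rw [Finset.mem_range] at hk
        rw [if_neg hk, smul_zero]
    simp_rw [e]
    rw [sum_norm_sq_dft hω h2N, ← Finset.sum_subset
      (Finset.range_subset_range.2 (by omega : N ≤ 2 * N))]
    · rw [Nat.cast_mul, Nat.cast_two]
      gcongr
      refine (Finset.sum_le_card_nsmul _ _ ((c * ‖H v‖) ^ 2) fun k hk => ?_).trans (by simp)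
      rw [if_pos (Finset.mem_range.1 hk)]
      gcongr
      rw [norm_smul, Complex.norm_real, Real.norm_of_nonneg (by positivity)]
      have h1 := (S ^ k).le_of_opNorm_le (hpow k) (H v)
      have h2 : r ^ k ≤ 1 := pow_le_one₀ hr0 hrlt.le
      calc _ ≤ 1 * ‖(S ^ k) (H v)‖ := by gcongr
        _ ≤ _ := by rwa [one_mul]
    · intro k _ hk
      rw [Finset.mem_range] at hk
      simp [hk]
  have step3 : ∑ j ∈ Finset.range (2 * N), ‖Q (R (P j (P j v)))‖ ^ 2 =
      2 * N * ∑ m ∈ Finset.range (2 * N),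
        ‖((triangleCoeff N m * r ^ m : ℝ) : ℂ) • Q (R ((S ^ m) v))‖ ^ 2 := by
    have e : ∀ j, Q (R (P j (P j v))) = ∑ k ∈ Finset.range (2 * N), ω ^ (j * k) •
        ((triangleCoeff N k * r ^ k : ℝ) : ℂ) • Q (R ((S ^ k) v)) := by
      intro j
      have : P j (P j v) =
          (∑ m ∈ Finset.range (2 * N), triangleCoeff N m • (z j • S) ^ m) v := by
        rw [← geom_sum_mul_self]; rfl
      rw [this]
      simp only [sum_apply, map_sum]
      refine Finset.sum_congr rfl fun k _ => ?_
      have e1 : (triangleCoeff N k • (z j • S) ^ k) v =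
          ((triangleCoeff N k : ℂ) * z j ^ k) • (S ^ k) v := by
        rw [smul_pow, ← Nat.cast_smul_eq_nsmul ℂ, smul_smul]; rfl
      rw [e1, map_smul, map_smul, smul_smul, hzpow]
      congr 1
      push_cast
      ring
    simp_rw [e]
    rw [sum_norm_sq_dft hω h2N]
    push_cast
    rfl
  have step4 : ∀ m ∈ Finset.range N, ((m : ℝ) + 1) ^ 2 * (1 / 2 * ‖Q ((S ^ N) v)‖ ^ 2) ≤
      μ ^ 2 * c ^ 2 * ‖((triangleCoeff N m * r ^ m : ℝ) : ℂ) • Q (R ((S ^ m) v))‖ ^ 2 := by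
    intro m hm
    rw [Finset.mem_range] at hm
    have h1 : ‖Q ((S ^ N) v)‖ ≤ μ * (c * ‖Q (R ((S ^ m) v))‖) := by
      have e : Q ((S ^ N) v) = (μ : ℂ) • (S ^ (N - 1 - m)) (Q (R ((S ^ m) v))) := by
        have e1 : S ^ N = S * (S ^ (N - 1 - m) * S ^ m) := by
          rw [← pow_add, ← pow_succ']; congr 1; omega
        have e2 : Commute S R := by rw [hS]; exact (Commute.refl R).smul_left _
        have e3 : Q * S ^ N = (μ : ℂ) • (S ^ (N - 1 - m) * (Q * (R * S ^ m))) := by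
          rw [e1]
          nth_rewrite 1 [hS]
          rw [smul_mul_assoc, mul_smul_comm, ← mul_assoc R, ← (e2.pow_left _).eq, mul_assoc,
            ← mul_assoc Q, (hQ.pow_right _).eq, mul_assoc]
        exact DFunLike.congr_fun e3 v
      rw [e, norm_smul, Complex.norm_real, Real.norm_of_nonneg hμ.le]
      gcongr
      exact (S ^ (N - 1 - m)).le_of_opNorm_le (hpow _) _
    have h2 : 1 / 2 ≤ (r ^ m) ^ 2 := by
      have hb := one_add_mul_le_pow (a := -(1 / (4 * (N : ℝ)))) (by linarith) (m * 2)
      rw [← pow_mul]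
      have : (1 + -(1 / (4 * (N : ℝ)))) = r := by rw [hr]; ring
      rw [this] at hb
      refine le_trans ?_ hb
      have hmN : (m : ℝ) ≤ N := by exact_mod_cast hm.le
      have : (m : ℝ) * (1 / (4 * N)) ≤ N * (1 / (4 * N)) := by gcongr
      have h4 : (N : ℝ) * (1 / (4 * N)) = 1 / 4 := by field_simp
      push_cast
      linarith
    have h3 : ((m : ℝ) + 1) ≤ triangleCoeff N m := by exact_mod_cast succ_le_triangleCoeff hm
    rw [norm_smul, Complex.norm_real, Real.norm_of_nonneg (by positivity)]
    calc ((m : ℝ) + 1) ^ 2 * (1 / 2 * ‖Q ((S ^ N) v)‖ ^ 2)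
        ≤ (triangleCoeff N m : ℝ) ^ 2 * ((r ^ m) ^ 2 * (μ * (c * ‖Q (R ((S ^ m) v))‖)) ^ 2) := by
          gcongr
      _ = _ := by ring
  have step5 : (N : ℝ) ^ 3 / 3 * (1 / 2 * ‖Q ((S ^ N) v)‖ ^ 2) ≤ μ ^ 2 * c ^ 2 *
      ∑ m ∈ Finset.range (2 * N),
        ‖((triangleCoeff N m * r ^ m : ℝ) : ℂ) • Q (R ((S ^ m) v))‖ ^ 2 := by
    calc _ ≤ (∑ m ∈ Finset.range N, ((m : ℝ) + 1) ^ 2) * (1 / 2 * ‖Q ((S ^ N) v)‖ ^ 2) := by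
          gcongr; exact cube_div_three_le_sum_sq N
      _ ≤ ∑ m ∈ Finset.range N, μ ^ 2 * c ^ 2 *
          ‖((triangleCoeff N m * r ^ m : ℝ) : ℂ) • Q (R ((S ^ m) v))‖ ^ 2 := by
          rw [Finset.sum_mul]; exact Finset.sum_le_sum step4
      _ ≤ _ := by
          rw [← Finset.mul_sum]
          gcongr
          omega
  have step6 := Finset.sum_le_sum fun j (_ : j ∈ Finset.range (2 * N)) => step1 j
  rw [step3, ← Finset.mul_sum] at step6
  set σ := ∑ m ∈ Finset.range (2 * N),
        ‖((triangleCoeff N m * r ^ m : ℝ) : ℂ) • Q (R ((S ^ m) v))‖ ^ 2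
  have step7 : 2 * N * σ ≤
      K ^ 2 * (1 + c) ^ 2 * (4 * N / μ) * (2 * N * (N * (c * ‖H v‖) ^ 2)) :=
    step6.trans (by gcongr)
  have step8 : (N : ℝ) ^ 3 / 3 * (1 / 2 * ‖Q ((S ^ N) v)‖ ^ 2) ≤ μ ^ 2 * c ^ 2 *
      (K ^ 2 * (1 + c) ^ 2 * (4 * N / μ) * (N * (c * ‖H v‖) ^ 2)) := by
    refine step5.trans ?_
    gcongr
    refine le_of_mul_le_mul_left (step7.trans_eq ?_) (by positivity : 0 < 2 * (N : ℝ))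
    ring
  have hpos : (0 : ℝ) < N ^ 3 / 6 := by positivity
  refine le_of_mul_le_mul_left ?_ hpos
  calc _ = (N : ℝ) ^ 3 / 3 * (1 / 2 * ‖Q ((S ^ N) v)‖ ^ 2) := by ring
    _ ≤ _ := step8
    _ = _ := by field_simp; ring

theorem norm_sq_apply_semigroup_le {X : Type*} [NormedAddCommGroup X] [InnerProductSpace ℂ X]
    [CompleteSpace X] {T : ℝ → X →L[ℂ] X} {c : ℝ} (hT : IsBddSemigroup T c)
    {R : ℂ → X →L[ℂ] X} (hR : ∀ μ : ℂ, 0 < μ.re → IsResolventAt T μ (R μ))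
    {Q H : X →L[ℂ] X} {K : ℝ} (hK : 0 ≤ K) (hQ : ∀ t, 0 ≤ t → Commute (T t) Q)
    (hH : ∀ t, 0 ≤ t → Commute (T t) H)
    (hW : ∀ μ : ℂ, 0 < μ.re → ∀ v, ‖Q (R μ v)‖ ≤ K * ‖H v‖ / √μ.re) {t : ℝ} (ht : 0 < t) (v : X) :
    ‖Q (T t v)‖ ^ 2 ≤ 24 * c ^ 4 * (1 + c) ^ 2 * K ^ 2 * t⁻¹ * ‖H v‖ ^ 2 := by
  have discrete : ∀ μ : ℝ, 0 < μ → ∀ N : ℕ, 1 ≤ N → ∀ v,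
      ‖Q ((((μ : ℂ) • R μ) ^ N) v)‖ ^ 2 ≤
        24 * c ^ 4 * (1 + c) ^ 2 * K ^ 2 * (μ / N) * ‖H v‖ ^ 2 := by
    intro μ hμ N hN v
    have hRμ := hR μ (by simpa using hμ)
    refine norm_sq_apply_pow_le hμ hK rfl (hRμ.norm_pow_le hT hμ)
      ((hRμ.commute hQ).symm.smul_right _) ((hRμ.commute hH).symm.smul_right _) ?_ hN v
    intro z hz
    have hre : μ * (1 - ‖z‖) ≤ ((μ : ℂ) * (1 - z)).re := by
      have h1 := Complex.re_le_norm z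
      have h2 : ((μ : ℂ) * (1 - z)).re = μ * (1 - z.re) := by simp
      rw [h2]
      gcongr
    have hpos : 0 < μ * (1 - ‖z‖) := mul_pos hμ (by linarith)
    refine ⟨R ((μ : ℂ) * (1 - z)), ?_, fun v => ?_⟩
    · have := hRμ.eq_mul (hR _ (hpos.trans_le hre))
      rw [smul_smul]
      convert this using 4
      ring
    · refine (hW _ (hpos.trans_le hre) v).trans ?_
      gcongr
  set J := R 1 with hJdef
  have hJ : IsResolventAt T 1 J := hR 1 (by simp)
  have hJgen : ∀ w, HasGenAt T (J w) (J w - w) := fun w => by simpa using hJ.hasGenAt w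
  have hdense : DenseRange (J ∘ J) := (hJ.denseRange hT).comp (hJ.denseRange hT) J.continuous
  refine hdense.induction_on (p := fun v => ‖Q (T t v)‖ ^ 2 ≤
    24 * c ^ 4 * (1 + c) ^ 2 * K ^ 2 * t⁻¹ * ‖H v‖ ^ 2) v ?_ ?_
  · exact isClosed_le (by fun_prop) (by fun_prop)
  intro w
  set x := (J ∘ J) w with hx
  have hxy : HasGenAt T x (J (J w - w)) := by
    have := hJgen (J w)
    rwa [map_sub]
  have hyz := hJgen (J w - w)
  set z := J (J w - w) - (J w - w)
  set μ : ℕ → ℝ := fun N => (t / ((N : ℝ) + 1))⁻¹ with hμ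
  have hμ0 : ∀ N, 0 < μ N := fun N => by simp only [hμ]; positivity
  have hlim : Tendsto (fun N : ℕ => (((μ N : ℂ) • R (μ N)) ^ (N + 1)) x) atTop (𝓝 (T t x)) := by
    rw [tendsto_iff_norm_sub_tendsto_zero]
    have hz : Tendsto (fun N : ℕ => (c * c) * (2 * c * ‖z‖) * t ^ 2 * (1 / ((N : ℝ) + 1))) atTop
        (𝓝 ((c * c) * (2 * c * ‖z‖) * t ^ 2 * 0)) :=
      (tendsto_one_div_add_atTop_nhds_zero_nat (𝕜 := ℝ)).const_mul _
    rw [mul_zero] at hz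
    refine squeeze_zero (fun N => norm_nonneg _) (fun N => ?_) hz
    have hh : 0 < t / ((N : ℝ) + 1) := by positivity
    have := (hR (μ N) (by simpa using hμ0 N)).norm_sub_pow_le hT hh hxy hyz (N + 1)
    have e : ((N + 1 : ℕ) : ℝ) * (t / ((N : ℝ) + 1)) = t := by push_cast; field_simp
    rw [e] at this
    rw [norm_sub_rev]
    refine this.trans_eq ?_
    push_cast
    field_simp
  have hlim2 : Tendsto (fun N : ℕ => ‖Q ((((μ N : ℂ) • R (μ N)) ^ (N + 1)) x)‖ ^ 2) atTop
      (𝓝 (‖Q (T t x)‖ ^ 2)) := ((Q.continuous.tendsto _).comp hlim).norm.pow 2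
  refine le_of_tendsto' hlim2 fun N => ?_
  have := discrete (μ N) (hμ0 N) (N + 1) (by omega) x
  have e : μ N / ((N + 1 : ℕ) : ℝ) = t⁻¹ := by simp only [hμ]; push_cast; field_simp
  rwa [e] at this

theorem exists_norm_le_mul_norm_one_sub {X : Type*} [NormedAddCommGroup X] [NormedSpace ℂ X]
    {T : ℝ → X →L[ℂ] X} {c : ℝ} (hT : IsBddSemigroup T c) {J : X →L[ℂ] X}
    (hJ : IsResolventAt T 1 J) {t : ℝ} (ht : 0 ≤ t) (hlt : ‖T t * J‖ ≤ 1 / 2) (x : X) :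
    ‖x‖ ≤ 2 * (1 + c * t) * ‖(1 - J) x‖ := by
  have hg : HasGenAt T (J x) (J x - x) := by simpa using hJ.hasGenAt x
  have h1 := hg.norm_sub_le hT ht
  have h2 : ‖T t (J x)‖ ≤ 1 / 2 * ‖x‖ := (T t * J).le_of_opNorm_le hlt x
  have e : (1 - J) x = x - J x := rfl
  rw [e]
  have h3 : ‖x‖ ≤ ‖x - J x‖ + ‖T t (J x)‖ + ‖T t (J x) - J x‖ := by
    calc ‖x‖ = ‖(x - J x) + T t (J x) - (T t (J x) - J x)‖ := by congr 1; abel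
      _ ≤ _ := (norm_sub_le _ _).trans (by gcongr; exact norm_add_le _ _)
  rw [norm_sub_rev (J x) x] at h1
  linarith

theorem norm_pow_apply_le_of_bounded_below {X : Type*} [NormedAddCommGroup X] [NormedSpace ℂ X]
    {J : X →L[ℂ] X} {κ : ℝ} (hκ : 0 ≤ κ) (h : ∀ x, ‖x‖ ≤ κ * ‖(1 - J) x‖) (k : ℕ) (u : X) :
    ‖(J ^ k) u‖ ≤ (‖J‖ * κ) ^ k * ‖((1 - J) ^ k) u‖ := by
  induction k generalizing u with
  | zero => simp
  | succ k ih =>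
    have e1 : (J ^ (k + 1)) u = J ((J ^ k) u) := by rw [pow_succ']; rfl
    have e2 : (1 - J) (((1 - J) ^ k) u) = ((1 - J) ^ (k + 1)) u := by rw [pow_succ']; rfl
    rw [e1]
    calc _ ≤ ‖J‖ * ‖(J ^ k) u‖ := J.le_opNorm _
      _ ≤ ‖J‖ * ((‖J‖ * κ) ^ k * (κ * ‖(1 - J) (((1 - J) ^ k) u)‖)) := by
        gcongr
        exact (ih u).trans (by gcongr; exact h _)
      _ = _ := by rw [e2]; ring

/-- Let `T` be a polynomially stable C₀-semigroup on a Hilbert space with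
generator `A` (bounded, with `‖T(t)(I−A)⁻¹‖ = O(t^{-1/α})` for some `α > 0`, where
`(I−A)⁻¹ = R(1,A)`), and let `C : D(A) → X` be relatively `A`-bounded and commute with
the semigroup.  If for some integer `n ≥ 1` the operator `C(−A)ⁿ` extends to a
relatively `A`-bounded `C̃ : D(A) → X` satisfying the 2-Weiss condition
`‖C̃ R(λ,A)x‖ ≤ K‖x‖/√(Re λ)`, then there are `M > 0` and `β' > 0` with
`‖C T(t)x‖ ≤ M t^{-(1+β')/2} ‖x‖` for `t > 0`, `x ∈ D(A)`; in particular `C T(t)`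
extends to a bounded operator of norm at most `M/√(t^{1+β'})`. -/
theorem stmt_19
    {X : Type*} [NormedAddCommGroup X] [InnerProductSpace ℂ X] [CompleteSpace X]
    (T : ℝ → X →L[ℂ] X)
    (hT0 : T 0 = 1)
    (hTsemi : ∀ s t : ℝ, 0 ≤ s → 0 ≤ t → T (s + t) = T s ∘L T t)
    (hTcont : ∀ x : X, ContinuousOn (fun t : ℝ => T t x) (Set.Ici 0))
    (hTbdd : ∃ c : ℝ, ∀ t : ℝ, 0 ≤ t → ‖T t‖ ≤ c)
    (Dom : Set X) (A : X → X)
    (hgen : ∀ x y, (x ∈ Dom ∧ A x = y) ↔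
      Filter.Tendsto (fun t : ℝ => (t : ℂ)⁻¹ • (T t x - x))
        (nhdsWithin 0 (Set.Ioi 0)) (nhds y))
    (R : ℂ → X →L[ℂ] X)
    (hR₁ : ∀ lam : ℂ, 0 < lam.re → ∀ x, R lam x ∈ Dom ∧ lam • R lam x - A (R lam x) = x)
    (hR₂ : ∀ lam : ℂ, 0 < lam.re → ∀ x ∈ Dom, R lam (lam • x - A x) = x)
    -- polynomial stability: ‖T(t)(I−A)⁻¹‖ = O(t^{-1/α}), with (I−A)⁻¹ = R(1,A)
    (hpoly : ∃ α : ℝ, 0 < α ∧ ∃ M₂ > 0, ∃ t₂ > 0, ∀ t : ℝ, t₂ ≤ t →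
      ‖(T t) ∘L (R 1)‖ ≤ M₂ * t ^ (-(1 / α)))
    (C : X → X)
    (hCadd : ∀ x ∈ Dom, ∀ y ∈ Dom, C (x + y) = C x + C y)
    (hCsmul : ∀ (a : ℂ), ∀ x ∈ Dom, C (a • x) = a • C x)
    (hCbdd : ∃ c₀ > 0, ∀ x ∈ Dom, ‖C x‖ ≤ c₀ * (‖x‖ + ‖A x‖))
    (hcomm : ∀ t : ℝ, 0 ≤ t → ∀ x ∈ Dom, T t (C x) = C (T t x))
    (n : ℕ) (hn : 1 ≤ n)
    (Ct : X → X)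
    (hCtadd : ∀ x ∈ Dom, ∀ y ∈ Dom, Ct (x + y) = Ct x + Ct y)
    (hCtsmul : ∀ (a : ℂ), ∀ x ∈ Dom, Ct (a • x) = a • Ct x)
    (hCtbdd : ∃ c₁ > 0, ∀ x ∈ Dom, ‖Ct x‖ ≤ c₁ * (‖x‖ + ‖A x‖))
    (hCtext : ∀ x ∈ iterDom Dom A (n + 1), Ct x = ((-1 : ℂ) ^ n) • C (A^[n] x))
    (hWeiss : ∃ K > 0, ∀ lam : ℂ, 0 < lam.re → ∀ x : X,
      ‖Ct (R lam x)‖ ≤ K * ‖x‖ / Real.sqrt lam.re) :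
    ∃ M > 0, ∃ β' : ℝ, 0 < β' ∧
      ((∀ t : ℝ, 0 < t → ∀ x ∈ Dom, ‖C (T t x)‖ ≤ M * t ^ (-(1 + β') / 2) * ‖x‖) ∧
      (∀ t : ℝ, 0 < t → ∃ S : X →L[ℂ] X,
        ‖S‖ ≤ M / Real.sqrt (t ^ (1 + β')) ∧ ∀ x ∈ Dom, S x = C (T t x))) := by

  obtain ⟨c, hc⟩ := hTbdd
  have hT : IsBddSemigroup T c := ⟨hT0, hTsemi, hTcont, hc⟩
  have hc0 : 0 ≤ c := (norm_nonneg _).trans (hc 0 le_rfl)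
  have hR : ∀ μ : ℂ, 0 < μ.re → IsResolventAt T μ (R μ) := by
    intro μ hμ
    refine ⟨fun x => (hgen _ _).1 ⟨(hR₁ μ hμ x).1, ?_⟩, fun x y hxy => ?_⟩
    · have := (hR₁ μ hμ x).2
      rw [eq_sub_iff_add_eq, ← eq_sub_iff_add_eq']
      exact this.symm
    · obtain ⟨hx, rfl⟩ := (hgen x y).2 hxy
      exact hR₂ μ hμ x hx
  set J := R 1 with hJdef
  have hJ : IsResolventAt T 1 J := hR 1 (by simp)
  have hJT : ∀ t, 0 ≤ t → Commute (T t) J := fun t ht => hJ.commute_semigroup hT ht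
  have hJdom : ∀ x, J x ∈ Dom := fun x => (hR₁ 1 (by simp) x).1
  have hAJ : ∀ x, A (J x) = (J - 1) x := by
    intro x
    have := (hR₁ 1 (by simp) x).2
    rw [one_smul, sub_eq_iff_eq_add, ← sub_eq_iff_eq_add'] at this
    exact this.symm
  have hJdense : DenseRange J := hJ.denseRange hT
  -- the bounded operator `W = C (I - A)⁻¹`
  obtain ⟨c₀, hc₀, hCb⟩ := hCbdd
  obtain ⟨W, hWC⟩ : ∃ W : X →L[ℂ] X, ∀ x, W x = C (J x) := by
    refine ⟨LinearMap.mkContinuous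
      { toFun := fun x => C (J x)
        map_add' := fun x y => by rw [map_add, hCadd _ (hJdom x) _ (hJdom y)]
        map_smul' := fun a x => by rw [map_smul, hCsmul _ _ (hJdom x)]; rfl }
      (c₀ * (‖J‖ + ‖J - 1‖)) fun x => ?_, fun x => rfl⟩
    refine (hCb _ (hJdom x)).trans ?_
    rw [hAJ, mul_assoc, add_mul]
    gcongr
    · exact J.le_opNorm x
    · exact (J - 1).le_opNorm x
  have hWT : ∀ t, 0 ≤ t → Commute (T t) W := by
    intro t ht
    refine ContinuousLinearMap.ext fun x => ?_
    change T t (W x) = W (T t x)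
    rw [hWC, hWC, hcomm t ht _ (hJdom x)]
    congr 1
    exact DFunLike.congr_fun (hJT t ht).eq x
  have hJW : Commute J W := hJ.commute hWT
  set Q : X →L[ℂ] X := (1 - J) ^ n * W with hQdef
  have hQT : ∀ t, 0 ≤ t → Commute (T t) Q := fun t ht =>
    (((Commute.one_right _).sub_right (hJT t ht)).pow_right n).mul_right (hWT t ht)
  have hHT : ∀ t, 0 ≤ t → Commute (T t) (J ^ (n + 1)) := fun t ht => (hJT t ht).pow_right _
  have hJB : Commute J (J - 1) := (Commute.refl J).sub_right (Commute.one_right J)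
  have hAJpow : ∀ k u, A ((J ^ (k + 1)) u) = (J ^ k) ((J - 1) u) := by
    intro k u
    rw [pow_succ']
    change A (J ((J ^ k) u)) = _
    rw [hAJ]
    exact (DFunLike.congr_fun (hJB.pow_left k).eq u).symm
  have hiter : ∀ k u, (J ^ k) u ∈ iterDom Dom A k := by
    intro k
    induction k with
    | zero => intro u; trivial
    | succ k ih =>
      intro u
      refine ⟨?_, ?_⟩
      · rw [pow_succ']; exact hJdom _
      · rw [hAJpow]; exact ih _
  have hAiter : ∀ k u, A^[k] ((J ^ (k + 1)) u) = J (((J - 1) ^ k) u) := by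
    intro k
    induction k with
    | zero => intro u; simp
    | succ k ih =>
      intro u
      rw [Function.iterate_succ_apply, hAJpow, ih, pow_succ]
      rfl
  have hCtQ : ∀ v, Ct ((J ^ (n + 1)) v) = Q v := by
    intro v
    rw [hCtext _ (hiter _ v), hAiter, ← hWC]
    have e : Q = (-1 : ℂ) ^ n • (W * (J - 1) ^ n) := by
      have h1 : (1 - J) = (-1 : ℂ) • (J - 1) := by rw [neg_one_smul, neg_sub]
      have h2 : Commute W ((J - 1) ^ n) :=
        (hJW.symm.sub_right (Commute.one_right W)).pow_right n
      rw [hQdef, h1, smul_pow, h2.eq, smul_mul_assoc]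
    rw [e]
    rfl
  obtain ⟨K, hK, hKW⟩ := hWeiss
  have hQR : ∀ μ : ℂ, 0 < μ.re → ∀ v,
      ‖Q (R μ v)‖ ≤ K * ‖(J ^ (n + 1)) v‖ / √μ.re := by
    intro μ hμ v
    rw [← hCtQ]
    have : (J ^ (n + 1)) (R μ v) = R μ ((J ^ (n + 1)) v) :=
      (DFunLike.congr_fun ((hR μ hμ).commute hHT).eq v).symm
    rw [this]
    exact hKW μ hμ _
  set κ₂ := 24 * c ^ 4 * (1 + c) ^ 2 * K ^ 2 with hκ₂
  have hQdecay : ∀ s, 0 < s → ∀ v,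
      ‖Q (T s v)‖ ≤ √κ₂ * s ^ (-(1 / 2) : ℝ) * ‖(J ^ (n + 1)) v‖ := by
    intro s hs v
    have h1 := norm_sq_apply_semigroup_le hT hR hK.le hQT hHT hQR hs v
    have hκ0 : 0 ≤ κ₂ := by positivity
    refine (pow_le_pow_iff_left₀ (norm_nonneg _) (by positivity) two_ne_zero).1 (h1.trans_eq ?_)
    rw [mul_pow, mul_pow, Real.sq_sqrt hκ0, ← Real.rpow_natCast (s ^ (-(1 / 2) : ℝ)) 2,
      ← Real.rpow_mul hs.le]
    have e : (-(1 / 2) : ℝ) * ((2 : ℕ) : ℝ) = -1 := by norm_num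
    rw [e, Real.rpow_neg_one]
  -- polynomial decay on all of `(0, ∞)` and invertibility of `A`
  obtain ⟨α, hα, M₂, hM₂, t₂, ht₂, hdec⟩ := hpoly
  have hdec' : ∀ t, 0 < t → ‖T t * J‖ ≤
      (M₂ + c * ‖J‖ * t₂ ^ (1 / α)) * t ^ (-(1 / α)) := by
    intro t ht
    have hp : 0 < t ^ (-(1 / α)) := by positivity
    rcases le_total t₂ t with h | h
    · refine (hdec t h).trans ?_
      gcongr
      have : 0 ≤ c * ‖J‖ * t₂ ^ (1 / α) := by positivity
      linarith
    · have h1 : ‖T t * J‖ ≤ c * ‖J‖ := (norm_mul_le _ _).trans (by gcongr; exact hc t ht.le)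
      have h2 : 1 ≤ t₂ ^ (1 / α) * t ^ (-(1 / α)) := by
        rw [Real.rpow_neg ht.le, ← div_eq_mul_inv, one_le_div (by positivity)]
        gcongr
      have h3 : 0 ≤ c * ‖J‖ := by positivity
      have h4 : 0 ≤ M₂ * t ^ (-(1 / α)) := by positivity
      nlinarith
  set M₃ := M₂ + c * ‖J‖ * t₂ ^ (1 / α) with hM₃
  have hM₃0 : 0 ≤ M₃ := by positivity
  obtain ⟨t₁, ht₁, hlt⟩ : ∃ t₁ : ℝ, 0 ≤ t₁ ∧ ‖T t₁ * J‖ ≤ 1 / 2 := by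
    have hlim : Tendsto (fun t : ℝ => M₃ * t ^ (-(1 / α))) atTop (𝓝 (M₃ * 0)) :=
      (tendsto_rpow_neg_atTop (by positivity)).const_mul _
    rw [mul_zero] at hlim
    obtain ⟨t₁, h1, h2⟩ := ((hlim.eventually_le_const (by norm_num : (0 : ℝ) < 1 / 2)).and
      (eventually_gt_atTop 0)).exists
    exact ⟨t₁, h2.le, (hdec' t₁ h2).trans h1⟩
  set κ := 2 * (1 + c * t₁) with hκ
  have hκ0 : 0 ≤ κ := by positivity
  have hbelow : ∀ x, ‖x‖ ≤ κ * ‖(1 - J) x‖ := exists_norm_le_mul_norm_one_sub hT hJ ht₁ hlt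
  obtain ⟨m, rfl⟩ : ∃ m, n = m + 1 := ⟨n - 1, by omega⟩
  set M := M₃ * ((‖J‖ * κ) ^ m * κ) * √κ₂ * (2 : ℝ) ^ ((1 + 2 / α) / 2) + 1 with hM
  have hM0 : 0 < M := by positivity
  have bound : ∀ t, 0 < t → ∀ y, ‖W (T t y)‖ ≤ M * t ^ (-(1 + 2 / α) / 2) * ‖J y‖ := by
    intro t ht y
    have hdense : DenseRange (J ^ (m + 1)) := by
      induction m + 1 with
      | zero => exact Function.surjective_id.denseRange
      | succ k ih =>
        rw [pow_succ']
        exact hJdense.comp ih J.continuous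
    refine hdense.induction_on (p := fun y =>
      ‖W (T t y)‖ ≤ M * t ^ (-(1 + 2 / α) / 2) * ‖J y‖) y
      (isClosed_le (by fun_prop) (by fun_prop)) fun v => ?_
    have hs : 0 < t / 2 := by positivity
    set u := W (T (t / 2) v) with hu
    have e1 : W (T t ((J ^ (m + 1)) v)) = (T (t / 2) * J) ((J ^ m) u) := by
      have e2 : T t = T (t / 2) * T (t / 2) := by
        rw [← hT.add _ _ hs.le hs.le, add_halves]
      have e3 : W * (T t * J ^ (m + 1)) = T (t / 2) * J * (J ^ m * (W * T (t / 2))) := by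
        have hc1 : Commute (W * T (t / 2)) (J ^ (m + 1)) :=
          (hJW.symm.mul_left (hJT _ hs.le)).pow_right _
        rw [e2, mul_assoc (T (t / 2)), ← mul_assoc W, ← (hWT _ hs.le).eq, mul_assoc (T (t / 2)),
          ← mul_assoc W, hc1.eq, pow_succ']
        simp only [mul_assoc]
        rw [(hWT _ hs.le).eq]
      exact DFunLike.congr_fun e3 v
    have e4 : (J ^ (m + 1 + 1)) v = J ((J ^ (m + 1)) v) := by rw [pow_succ']; rfl
    have e5 : (1 - J) (((1 - J) ^ m) u) = Q (T (t / 2) v) := by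
      rw [hQdef, pow_succ']; rfl
    have h1 : ‖(J ^ m) u‖ ≤ (‖J‖ * κ) ^ m * (κ * ‖Q (T (t / 2) v)‖) := by
      rw [← e5]
      refine (norm_pow_apply_le_of_bounded_below hκ0 hbelow m u).trans ?_
      gcongr
      exact hbelow _
    have h2 := hQdecay (t / 2) hs v
    rw [e4] at h2
    have hpow : (t / 2) ^ (-(1 / α)) * (t / 2) ^ (-(1 / 2) : ℝ) =
        (2 : ℝ) ^ ((1 + 2 / α) / 2) * t ^ (-(1 + 2 / α) / 2) := by
      rw [← Real.rpow_add hs, Real.div_rpow ht.le (by norm_num), div_eq_mul_inv,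
        ← Real.rpow_neg (by norm_num), mul_comm]
      congr 2 <;> field_simp <;> ring
    rw [e1]
    calc ‖(T (t / 2) * J) ((J ^ m) u)‖
        ≤ (M₃ * (t / 2) ^ (-(1 / α))) * ((‖J‖ * κ) ^ m * (κ *
          (√κ₂ * (t / 2) ^ (-(1 / 2) : ℝ) * ‖J ((J ^ (m + 1)) v)‖))) := by
          refine ((T (t / 2) * J).le_of_opNorm_le (hdec' _ hs) _).trans ?_
          gcongr
          exact h1.trans (by gcongr)
      _ = M₃ * ((‖J‖ * κ) ^ m * κ) * √κ₂ * ((t / 2) ^ (-(1 / α)) * (t / 2) ^ (-(1 / 2) : ℝ)) *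
          ‖J ((J ^ (m + 1)) v)‖ := by ring
      _ = (M₃ * ((‖J‖ * κ) ^ m * κ) * √κ₂ * (2 : ℝ) ^ ((1 + 2 / α) / 2)) *
          t ^ (-(1 + 2 / α) / 2) * ‖J ((J ^ (m + 1)) v)‖ := by rw [hpow]; ring
      _ ≤ _ := by gcongr; rw [hM]; linarith
  have hDomJ : ∀ x ∈ Dom, J (x - A x) = x := fun x hx => by
    simpa using hR₂ 1 (by simp) x hx
  have hCW : ∀ t, 0 ≤ t → ∀ x ∈ Dom, C (T t x) = W (T t (x - A x)) := by
    intro t ht x hx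
    rw [hWC]
    congr 1
    conv_lhs => rw [← hDomJ x hx]
    exact DFunLike.congr_fun (hJT t ht).eq _
  refine ⟨M, hM0, 2 / α, by positivity, fun t ht x hx => ?_, fun t ht => ?_⟩
  · rw [hCW t ht.le x hx]
    simpa only [hDomJ x hx] using bound t ht (x - A x)
  · have hb : ∀ y, ‖((W * T t : X →L[ℂ] X) : X →ₗ[ℂ] X) y‖ ≤
        M * t ^ (-(1 + 2 / α) / 2) * ‖(J : X →ₗ[ℂ] X) y‖ := bound t ht
    refine ⟨LinearMap.extendOfNorm ((W * T t : X →L[ℂ] X) : X →ₗ[ℂ] X) (J : X →ₗ[ℂ] X), ?_, ?_⟩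
    · refine (LinearMap.opNorm_extendOfNorm_le hJdense (by positivity) hb).trans_eq ?_
      rw [Real.sqrt_eq_rpow, ← Real.rpow_mul ht.le, div_eq_mul_inv M, ← Real.rpow_neg ht.le]
      congr 2
      ring
    · intro x hx
      have := LinearMap.extendOfNorm_eq (f := ((W * T t : X →L[ℂ] X) : X →ₗ[ℂ] X))
        (e := (J : X →ₗ[ℂ] X)) hJdense ⟨_, hb⟩ (x - A x)
      have e : (J : X →ₗ[ℂ] X) (x - A x) = x := hDomJ x hx
      rw [e] at this
      rw [this, hCW t ht.le x hx]
      rfl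
end
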